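/- arXiv:2006.08499 — 9 statements merged into one kernel-verified Lean document; each statement's English description precedes it below -/
import Mathlib

section
/- A group G, viewed as a semigroup, is completely separable if and only if G is finite. -/
open scoped Pointwise

/-- A semigroup is residually finite if distinct points can be distinguished in a
finite semigroup quotient (image). -/
def IsResiduallyFiniteSemigroup (S : Type*) [Semigroup S] : Prop :=
  ∀ s t : S, s ≠ t →
    ∃ (U : Type) (_ : Semigroup U) (_ : Finite U) (f : S →ₙ* U), f s ≠ f t

/-- A semigroup is weakly subsemigroup separable if every element outside a finitely
generated subsemigroup can be separated from it in a finite semigroup image. -/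
def IsWeaklySubsemigroupSeparable (S : Type*) [Semigroup S] : Prop :=
  ∀ T : Subsemigroup S, (∃ Y : Finset S, T = Subsemigroup.closure (Y : Set S)) →
    ∀ s : S, s ∉ T →
      ∃ (U : Type) (_ : Semigroup U) (_ : Finite U) (f : S →ₙ* U),
        f s ∉ f '' (T : Set S)

/-- A semigroup is strongly subsemigroup separable if every element outside a
subsemigroup can be separated from it in a finite semigroup image. -/
def IsStronglySubsemigroupSeparable (S : Type*) [Semigroup S] : Prop :=
  ∀ T : Subsemigroup S, ∀ s : S, s ∉ T →
    ∃ (U : Type) (_ : Semigroup U) (_ : Finite U) (f : S →ₙ* U),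
      f s ∉ f '' (T : Set S)

/-- A semigroup is completely separable if every element can be separated from its
complement in a finite semigroup image. -/
def IsCompletelySeparable (S : Type*) [Semigroup S] : Prop :=
  ∀ s : S,
    ∃ (U : Type) (_ : Semigroup U) (_ : Finite U) (f : S →ₙ* U),
      f s ∉ f '' {t : S | t ≠ s}

/-- A semigroup is locally finite if every finitely generated subsemigroup is finite. -/
def IsLocallyFiniteSemigroup (S : Type*) [Semigroup S] : Prop :=
  ∀ Y : Finset S, ((Subsemigroup.closure (Y : Set S) : Subsemigroup S) : Set S).Finite

/-- A group is weakly subgroup separable (LERF) if every element outside a finitely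
generated subgroup can be separated from it in a finite group image. -/
def IsWeaklySubgroupSeparable (G : Type*) [Group G] : Prop :=
  ∀ H : Subgroup G, H.FG → ∀ g : G, g ∉ H →
    ∃ (K : Type) (_ : Group K) (_ : Finite K) (f : G →* K),
      f g ∉ f '' (H : Set G)

/-- A group is strongly subgroup separable (ERF) if every element outside a subgroup
can be separated from it in a finite group image. -/
def IsStronglySubgroupSeparable (G : Type*) [Group G] : Prop :=
  ∀ H : Subgroup G, ∀ g : G, g ∉ H →
    ∃ (K : Type) (_ : Group K) (_ : Finite K) (f : G →* K),
      f g ∉ f '' (H : Set G)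

/-- Green's relation H: x H y iff xS¹ = yS¹ and S¹x = S¹y. -/
def GreenH {S : Type*} [Semigroup S] (x y : S) : Prop :=
  insert x {z : S | ∃ s : S, z = x * s} = insert y {z : S | ∃ s : S, z = y * s} ∧
  insert x {z : S | ∃ s : S, z = s * x} = insert y {z : S | ∃ s : S, z = s * y}

/-- The H-class of an element. -/
def HClass {S : Type*} [Semigroup S] (x : S) : Set S := {y : S | GreenH x y}

/-- The n-fold pointwise product A·A⋯A (for n ≥ 1; we set the value at 0 to be A). -/
def SetNPow {S : Type*} [Semigroup S] (A : Set S) : ℕ → Set S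
  | 0 => A
  | 1 => A
  | n + 2 => SetNPow A (n + 1) * A

/-- The right stabiliser Stab(H) = {s ∈ S¹ | Hs = H}, a submonoid of S¹ = WithOne S. -/
def SchStab {S : Type*} [Semigroup S] (H : Set S) : Submonoid (WithOne S) where
  carrier := {s : WithOne S |
    (fun h => h * s) '' ((fun x : S => (x : WithOne S)) '' H)
      = (fun x : S => (x : WithOne S)) '' H}
  one_mem' := by
    simp only [Set.mem_setOf_eq, mul_one, Set.image_id']
  mul_mem' := by
    intro a b ha hb
    simp only [Set.mem_setOf_eq] at ha hb ⊢
    have hcomp : (fun h : WithOne S => h * (a * b))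
        = (fun h : WithOne S => h * b) ∘ fun h : WithOne S => h * a := by
      funext h; simp [mul_assoc]
    rw [hcomp, Set.image_comp, ha, hb]

/-- `(Γ, φ)` realises the Schützenberger group of the H-class `H`: `φ` is a surjective
monoid homomorphism from `Stab(H)` onto the group `Γ` whose kernel relation is exactly
the Schützenberger congruence `σ_H`. -/
def IsSchutzenbergerGroup {S : Type*} [Semigroup S] (H : Set S) (Γ : Type*) [Group Γ]
    (φ : SchStab H →* Γ) : Prop :=
  Function.Surjective φ ∧
    ∀ a b : SchStab H,
      φ a = φ b ↔ ∀ h ∈ H,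
        (h : WithOne S) * (a : WithOne S) = (h : WithOne S) * (b : WithOne S)

theorem group_completely_separable_iff_finite (G : Type*) [Group G] :
    IsCompletelySeparable G ↔ Finite G := by
  constructor
  · intro h
    obtain ⟨U, _, _, f, hf⟩ := h 1
    refine Finite.of_injective f fun a b hab => ?_
    by_contra hne
    refine hf ⟨a * b⁻¹, fun h1 => hne (mul_inv_eq_one.mp h1), ?_⟩
    rw [map_mul, hab, ← map_mul, mul_inv_cancel]
  · intro _ s
    let e : G ≃* Shrink.{0} G := Shrink.mulEquiv.symm
    refine ⟨Shrink.{0} G, inferInstance, Finite.of_equiv G e.toEquiv, e, ?_⟩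
    rintro ⟨t, hts, hft⟩
    exact hts (e.injective hft)
end

section
/- Let G be a group, viewed as a semigroup. Then: (1) G is weakly subsemigroup separable if and only if G is torsion and weakly subgroup separable; (2) G is strongly subsemigroup separable if and only if G is torsion and strongly subgroup separable. -/
open scoped Pointwise

/-- A semigroup homomorphism from a group to a finite semigroup has the same kernel relation
as some group homomorphism to a finite group. -/
theorem exists_monoidHom_finite_ker_eq {G : Type*} [Group G] {U : Type} [Semigroup U] [Finite U]
    (f : G →ₙ* U) :
    ∃ (K : Type) (_ : Group K) (_ : Finite K) (φ : G →* K), ∀ x y, φ x = φ y ↔ f x = f y := by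
  have hinj : Function.Injective
      (fun q : (Con.ker f).Quotient => Con.liftOn q f (fun _ _ h => h)) := by
    rintro ⟨x⟩ ⟨y⟩ h
    exact (Con.eq (Con.ker f)).2 h
  have hfin : Finite (Con.ker f).Quotient := Finite.of_injective _ hinj
  refine ⟨Shrink.{0} (Con.ker f).Quotient, inferInstance,
    Finite.of_equiv _ (equivShrink.{0} (Con.ker f).Quotient),
    (Shrink.mulEquiv.symm : (Con.ker f).Quotient ≃* _).toMonoidHom.comp (Con.mk' (Con.ker f)),
    fun x y => ?_⟩
  refine (EquivLike.injective Shrink.mulEquiv.symm).eq_iff.trans ?_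
  exact Con.eq (Con.ker f)

/-- An element and a subset of a group that are separated in a finite semigroup image are
separated in a finite group image. -/
theorem exists_monoidHom_notMem_image {G : Type*} [Group G] {A : Set G} {g : G}
    (h : ∃ (U : Type) (_ : Semigroup U) (_ : Finite U) (f : G →ₙ* U), f g ∉ f '' A) :
    ∃ (K : Type) (_ : Group K) (_ : Finite K) (f : G →* K), f g ∉ f '' A := by
  obtain ⟨U, _, _, f, hf⟩ := h
  obtain ⟨K, iK, iF, φ, hφ⟩ := exists_monoidHom_finite_ker_eq f
  refine ⟨K, iK, iF, φ, ?_⟩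
  rintro ⟨a, ha, hag⟩
  exact hf ⟨a, ha, (hφ a g).1 hag⟩

theorem exists_mulHom_notMem_image {G : Type*} [Group G] {A : Set G} {g : G}
    (h : ∃ (K : Type) (_ : Group K) (_ : Finite K) (f : G →* K), f g ∉ f '' A) :
    ∃ (U : Type) (_ : Semigroup U) (_ : Finite U) (f : G →ₙ* U), f g ∉ f '' A := by
  obtain ⟨K, _, iF, f, hf⟩ := h
  exact ⟨K, inferInstance, iF, f.toMulHom, hf⟩

theorem exists_mulHom_notMem_image_empty {S : Type*} [Semigroup S] (s : S) :
    ∃ (U : Type) (_ : Semigroup U) (_ : Finite U) (f : S →ₙ* U), f s ∉ f '' (∅ : Set S) :=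
  ⟨Unit, inferInstance, inferInstance, ⟨fun _ => (), fun _ _ => rfl⟩, by simp⟩

theorem IsStronglySubsemigroupSeparable.isWeaklySubsemigroupSeparable {S : Type*} [Semigroup S]
    (h : IsStronglySubsemigroupSeparable S) : IsWeaklySubsemigroupSeparable S :=
  fun T _ => h T

theorem Subsemigroup.pow_mem_of_pos {M : Type*} [Monoid M] (T : Subsemigroup M) {x : M}
    (hx : x ∈ T) {n : ℕ} (hn : 0 < n) : x ^ n ∈ T := by
  induction n, hn using Nat.le_induction with
  | base => simpa using hx
  | succ n _ ih => rw [pow_succ]; exact T.mul_mem ih hx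

theorem Subsemigroup.exists_pow_of_mem_closure_singleton {M : Type*} [Monoid M] {x y : M}
    (hy : y ∈ Subsemigroup.closure ({x} : Set M)) : ∃ n : ℕ, 0 < n ∧ x ^ n = y := by
  induction hy using Subsemigroup.closure_induction with
  | mem z hz => exact ⟨1, one_pos, by rw [pow_one, Set.mem_singleton_iff.1 hz]⟩
  | mul a b _ _ ha hb =>
    obtain ⟨m, hm, rfl⟩ := ha
    obtain ⟨n, _, rfl⟩ := hb
    exact ⟨m + n, by omega, pow_add x m n⟩

/-- A nonempty subsemigroup of a torsion group is a subgroup. -/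
theorem Subsemigroup.exists_subgroup_coe_eq_of_isTorsion {G : Type*} [Group G]
    (hG : Monoid.IsTorsion G) (T : Subsemigroup G) (hT : (T : Set G).Nonempty) :
    ∃ H : Subgroup G, (H : Set G) = T := by
  obtain ⟨t, ht⟩ := hT
  have hone : (1 : G) ∈ T := by
    rw [← pow_orderOf_eq_one t]
    exact T.pow_mem_of_pos ht (hG t).orderOf_pos
  refine ⟨{ carrier := T, mul_mem' := T.mul_mem, one_mem' := hone, inv_mem' := ?_ }, rfl⟩
  intro x hx
  obtain ⟨n, hn, hxn⟩ := isOfFinOrder_iff_pow_eq_one.1 (hG x)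
  obtain ⟨k, rfl⟩ := Nat.exists_eq_succ_of_ne_zero hn.ne'
  have hinv : x⁻¹ = x ^ k := inv_eq_of_mul_eq_one_right (by rw [← pow_succ']; exact hxn)
  change x⁻¹ ∈ T
  rw [hinv]
  rcases k.eq_zero_or_pos with rfl | hk
  · simpa using hone
  · exact T.pow_mem_of_pos hx hk

theorem IsWeaklySubsemigroupSeparable.isTorsion {G : Type*} [Group G]
    (h : IsWeaklySubsemigroupSeparable G) : Monoid.IsTorsion G := by
  intro g
  by_contra hg
  have hone : (1 : G) ∉ Subsemigroup.closure ({g} : Set G) := fun hmem =>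
    hg (isOfFinOrder_iff_pow_eq_one.2 (Subsemigroup.exists_pow_of_mem_closure_singleton hmem))
  obtain ⟨K, _, _, f, hf⟩ := exists_monoidHom_notMem_image
    (h (Subsemigroup.closure {g}) ⟨{g}, by rw [Finset.coe_singleton]⟩ 1 hone)
  refine hf ⟨g ^ orderOf (f g), ?_, by rw [map_pow, pow_orderOf_eq_one, map_one]⟩
  exact Subsemigroup.pow_mem_of_pos _ (Subsemigroup.subset_closure (Set.mem_singleton g))
    (orderOf_pos _)

/-- A finitely generated subgroup is finitely generated as a subsemigroup. -/
theorem Subgroup.FG.exists_finset_subsemigroup_closure_eq {G : Type*} [Group G] {H : Subgroup G}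
    (hH : H.FG) :
    ∃ Y : Finset G, H.toSubsemigroup = Subsemigroup.closure (Y : Set G) := by
  classical
  obtain ⟨Y, hY⟩ := (Subgroup.fg_iff_submonoid_fg H).1 hH
  have hmem (x : G) : x ∈ H ↔ x ∈ Submonoid.closure (Y : Set G) := by
    rw [hY, Subgroup.mem_toSubmonoid]
  refine ⟨insert 1 Y, le_antisymm (fun x hx => ?_) (Subsemigroup.closure_le.2 ?_)⟩
  · have hx' := (hmem x).1 hx
    induction hx' using Submonoid.closure_induction with
    | mem z hz => exact Subsemigroup.subset_closure (by simp [Finset.mem_coe.1 hz])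
    | one => exact Subsemigroup.subset_closure (by simp)
    | mul a b ha hb iha ihb =>
      exact Subsemigroup.mul_mem _ (iha ((hmem a).2 ha)) (ihb ((hmem b).2 hb))
  · intro x hx
    rcases Finset.mem_insert.1 (Finset.mem_coe.1 hx) with rfl | hx
    · exact H.one_mem
    · exact (hmem x).2 (Submonoid.subset_closure hx)

theorem Subgroup.fg_of_coe_eq_subsemigroup_closure {G : Type*} [Group G] {H : Subgroup G}
    {Y : Finset G} (h : (H : Set G) = Subsemigroup.closure (Y : Set G)) : H.FG := by
  refine ⟨Y, le_antisymm ?_ fun x hx => ?_⟩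
  · rw [Subgroup.closure_le, h]
    exact Subsemigroup.subset_closure
  · have hx' : x ∈ Subsemigroup.closure (Y : Set G) := by
      rwa [← SetLike.mem_coe, ← h]
    have hle : Subsemigroup.closure (Y : Set G) ≤
        (Subgroup.closure (Y : Set G)).toSubsemigroup :=
      Subsemigroup.closure_le.2 Subgroup.subset_closure
    exact hle hx'

theorem group_semigroup_separability (G : Type*) [Group G] :
    (IsWeaklySubsemigroupSeparable G ↔ Monoid.IsTorsion G ∧ IsWeaklySubgroupSeparable G) ∧
    (IsStronglySubsemigroupSeparable G ↔ Monoid.IsTorsion G ∧ IsStronglySubgroupSeparable G) := by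
  refine ⟨⟨fun h => ⟨h.isTorsion, fun H hH g hg => ?_⟩, fun ⟨ht, h⟩ T hT s hs => ?_⟩,
    ⟨fun h => ⟨h.isWeaklySubsemigroupSeparable.isTorsion, fun H g hg => ?_⟩,
      fun ⟨ht, h⟩ T s hs => ?_⟩⟩
  · exact exists_monoidHom_notMem_image
      (h H.toSubsemigroup hH.exists_finset_subsemigroup_closure_eq g hg)
  · rcases (T : Set G).eq_empty_or_nonempty with hempty | hne
    · rw [hempty]
      exact exists_mulHom_notMem_image_empty s
    · obtain ⟨H, hHT⟩ := T.exists_subgroup_coe_eq_of_isTorsion ht hne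
      obtain ⟨Y, rfl⟩ := hT
      rw [← SetLike.mem_coe, ← hHT] at hs
      rw [← hHT]
      exact exists_mulHom_notMem_image
        (h H (Subgroup.fg_of_coe_eq_subsemigroup_closure hHT) s hs)
  · exact exists_monoidHom_notMem_image (h H.toSubsemigroup g hg)
  · rcases (T : Set G).eq_empty_or_nonempty with hempty | hne
    · rw [hempty]
      exact exists_mulHom_notMem_image_empty s
    · obtain ⟨H, hHT⟩ := T.exists_subgroup_coe_eq_of_isTorsion ht hne
      rw [← SetLike.mem_coe, ← hHT] at hs
      rw [← hHT]
      exact exists_mulHom_notMem_image (h H s hs)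
end

section
/- Let S be a semigroup which is both residually finite and locally finite. Then S is weakly subsemigroup separable. -/
open scoped Pointwise

theorem weakly_separable_of_rf_locally_finite (S : Type*) [Semigroup S]
    (h1 : IsResiduallyFiniteSemigroup S) (h2 : IsLocallyFiniteSemigroup S) :
    IsWeaklySubsemigroupSeparable S := by
  rintro T ⟨Y, rfl⟩ s hs
  have hfin := h2 Y
  set T := Subsemigroup.closure (Y : Set S)
  have : Finite T := hfin
  have hne : ∀ t : T, s ≠ t := fun t h => hs (h ▸ t.2)
  choose U hU hUfin f hf using fun t : T => h1 s t (hne t)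
  obtain ⟨n, ⟨e⟩⟩ := Finite.exists_equiv_fin T
  refine ⟨∀ i : Fin n, U (e.symm i), inferInstance, inferInstance,
    { toFun := fun x i => f (e.symm i) x
      map_mul' := fun x y => funext fun i => map_mul (f (e.symm i)) x y }, ?_⟩
  rintro ⟨t, ht, h⟩
  have h' := congrFun h (e ⟨t, ht⟩)
  refine hf (e.symm (e ⟨t, ht⟩)) ?_
  simpa using h'.symm
end

section
/- An abelian group A, viewed as a semigroup, is weakly subsemigroup separable if and only if A is torsion and residually finite. -/
open scoped Pointwise

/-- An element of infinite order cannot be separated from the identity by its positive powers. -/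
theorem IsWeaklySubsemigroupSeparable.isMulTorsion {G : Type*} [Group G]
    (h : IsWeaklySubsemigroupSeparable G) : IsMulTorsion G := by
  intro a
  by_contra ha
  have hT : (1 : G) ∉ Subsemigroup.closure (({a} : Finset G) : Set G) := by
    intro h1
    have key : ∀ x ∈ Subsemigroup.closure (({a} : Finset G) : Set G),
        ∃ n : ℕ, 0 < n ∧ a ^ n = x := by
      intro x hx
      induction hx using Subsemigroup.closure_induction with
      | mem x hx => exact ⟨1, one_pos, by rw [pow_one, Finset.mem_singleton.mp (Finset.mem_coe.mp hx)]⟩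
      | mul x y _ _ hx hy =>
        obtain ⟨m, hm, rfl⟩ := hx
        obtain ⟨n, _, rfl⟩ := hy
        exact ⟨m + n, by omega, pow_add a m n⟩
    exact ha (isOfFinOrder_iff_pow_eq_one.mpr (key 1 h1))
  obtain ⟨U, _, _, f, hf⟩ := h _ ⟨{a}, rfl⟩ 1 hT
  have hpow : ∀ n : ℕ, a ^ (n + 1) ∈ Subsemigroup.closure (({a} : Finset G) : Set G) := by
    intro n
    induction n with
    | zero => simpa using Subsemigroup.subset_closure (s := {a}) rfl
    | succ n ih =>
      rw [pow_succ]
      exact mul_mem ih (Subsemigroup.subset_closure (by simp))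
  obtain ⟨i, j, hij, hfij⟩ :=
    Finite.exists_ne_map_eq_of_infinite fun n : ℕ => f (a ^ n)
  wlog hlt : i < j generalizing i j
  · exact this j i hij.symm hfij.symm (by omega)
  obtain ⟨k, rfl⟩ := Nat.exists_eq_add_of_lt hlt
  refine hf ⟨a ^ (k + 1), hpow k, ?_⟩
  have hmul := congrArg (f ((a ^ i)⁻¹) * ·) hfij
  simp only [← map_mul, inv_mul_cancel, add_assoc, pow_add a i, inv_mul_cancel_left] at hmul
  exact hmul.symm

theorem IsWeaklySubsemigroupSeparable.isResiduallyFiniteSemigroup {G : Type*} [Group G]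
    (h : IsWeaklySubsemigroupSeparable G) : IsResiduallyFiniteSemigroup G := by
  intro s t hst
  have hT : s * t⁻¹ ∉ Subsemigroup.closure (({1} : Finset G) : Set G) := by
    intro hmem
    have key : ∀ x ∈ Subsemigroup.closure (({1} : Finset G) : Set G), x = 1 := by
      intro x hx
      induction hx using Subsemigroup.closure_induction with
      | mem x hx => simpa using hx
      | mul x y _ _ hx hy => simp [hx, hy]
    exact hst (mul_inv_eq_one.mp (key _ hmem))
  obtain ⟨U, hU, hfin, f, hf⟩ := h _ ⟨{1}, rfl⟩ _ hT
  refine ⟨U, hU, hfin, f, fun heq => hf ⟨1, Subsemigroup.subset_closure (by simp), ?_⟩⟩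
  rw [map_mul, heq, ← map_mul, mul_inv_cancel]

/-- In a residually finite semigroup, a point can be separated from a finite set. -/
theorem IsResiduallyFiniteSemigroup.exists_notMem_image {S : Type*} [Semigroup S]
    (h : IsResiduallyFiniteSemigroup S) {F : Set S} (hF : F.Finite) {s : S} (hs : s ∉ F) :
    ∃ (U : Type) (_ : Semigroup U) (_ : Finite U) (f : S →ₙ* U), f s ∉ f '' F := by
  induction F, hF using Set.Finite.induction_on with
  | empty => exact ⟨Unit, inferInstance, inferInstance, ⟨fun _ => (), fun _ _ => rfl⟩, by simp⟩
  | @insert t F _ _ ih =>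
    rw [Set.mem_insert_iff, not_or] at hs
    obtain ⟨U, _, _, f, hf⟩ := ih hs.2
    obtain ⟨V, _, _, g, hg⟩ := h s t hs.1
    refine ⟨U × V, inferInstance, inferInstance, f.prod g, ?_⟩
    rintro ⟨x, rfl | hx, hxs⟩
    · exact hg (congrArg Prod.snd hxs).symm
    · exact hf ⟨x, hx, congrArg Prod.fst hxs⟩

theorem IsMulTorsion.isLocallyFiniteSemigroup {A : Type*} [CommGroup A]
    (h : IsMulTorsion A) : IsLocallyFiniteSemigroup A := by
  intro Y
  have : Finite (Subgroup.closure (Y : Set A)) :=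
    CommGroup.finite_of_fg_isMulTorsion _ (h.subgroup _)
  refine (Set.toFinite (Subgroup.closure (Y : Set A) : Set A)).subset ?_
  exact Subsemigroup.closure_le (S := (Subgroup.closure (Y : Set A)).toSubsemigroup).mpr
    Subgroup.subset_closure

theorem abelian_group_weakly_separable_iff (A : Type*) [CommGroup A] :
    IsWeaklySubsemigroupSeparable A ↔ Monoid.IsTorsion A ∧ IsResiduallyFiniteSemigroup A := by
  refine ⟨fun h => ⟨h.isMulTorsion, h.isResiduallyFiniteSemigroup⟩, ?_⟩
  rintro ⟨htors, hrf⟩ _ ⟨Y, rfl⟩ s hs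
  exact hrf.exists_notMem_image (IsMulTorsion.isLocallyFiniteSemigroup htors Y) hs
end

section
/- The additive group ℤ of integers, viewed as a semigroup, is not weakly subsemigroup separable: for every finite semigroup U and every homomorphism φ : ℤ → U, the image φ(−1) lies in φ(ℕ), where ℕ = {1, 2, 3, …} is the subsemigroup of ℤ generated by 1. -/
open scoped Pointwise

/-- A homomorphism from `ℤ` to a finite additive semigroup sends `-1` into the image of the
positive integers. -/
theorem AddHom.map_neg_one_mem_image_pos {U : Type*} [AddSemigroup U] [Finite U]
    (φ : AddHom ℤ U) : φ (-1) ∈ φ '' {n : ℤ | 0 < n} := by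
  obtain ⟨m, n, hmn, h⟩ := Finite.exists_ne_map_eq_of_infinite fun n : ℕ => φ (2 * n)
  wlog hlt : m < n generalizing m n
  · exact this n m hmn.symm h.symm (by omega)
  refine ⟨2 * n + (-1 - 2 * m), show (0 : ℤ) < _ by omega, ?_⟩
  rw [map_add, ← h, ← map_add]
  congr 1
  ring

/-- The subsemigroup of `ℤ` generated by `1` consists of the positive integers. -/
theorem mem_closure_ofAdd_one_iff (x : Multiplicative ℤ) :
    x ∈ Subsemigroup.closure {Multiplicative.ofAdd (1 : ℤ)} ↔ 0 < x.toAdd := by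
  constructor
  · intro hx
    induction hx using Subsemigroup.closure_induction with
    | mem x hx => rw [Set.mem_singleton_iff.mp hx]; exact one_pos
    | mul x y _ _ hx hy => exact add_pos hx hy
  · suffices ∀ n : ℤ, 1 ≤ n → Multiplicative.ofAdd n ∈
        Subsemigroup.closure {Multiplicative.ofAdd (1 : ℤ)} from fun hx => this x.toAdd hx
    intro n hn
    induction n, hn using Int.leInduction with
    | base => exact Subsemigroup.mem_closure_of_mem rfl
    | succ k _ ih =>
      rw [ofAdd_add]
      exact mul_mem ih (Subsemigroup.mem_closure_of_mem rfl)

theorem int_not_weakly_subsemigroup_separable :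
    (¬ IsWeaklySubsemigroupSeparable (Multiplicative ℤ)) ∧
    ∀ (U : Type) (_ : AddSemigroup U) (_ : Finite U) (φ : AddHom ℤ U),
      φ (-1) ∈ φ '' {n : ℤ | 0 < n} := by
  refine ⟨fun hsep => ?_, fun U _ _ φ => φ.map_neg_one_mem_image_pos⟩
  obtain ⟨U, _, _, f, hf⟩ := hsep (Subsemigroup.closure {Multiplicative.ofAdd (1 : ℤ)})
    ⟨{Multiplicative.ofAdd 1}, by simp⟩ (Multiplicative.ofAdd (-1)) (by
      rw [mem_closure_ofAdd_one_iff, toAdd_ofAdd]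
      norm_num)
  let φ : AddHom ℤ (Additive U) :=
    ⟨fun n => Additive.ofMul (f (Multiplicative.ofAdd n)), fun a b => by
      rw [ofAdd_add, map_mul, ofMul_mul]⟩
  obtain ⟨n, hn, h⟩ := φ.map_neg_one_mem_image_pos
  exact hf ⟨Multiplicative.ofAdd n, (mem_closure_ofAdd_one_iff _).mpr hn, h⟩
end

section
/- Let S be a semigroup, let H be an H-class of S, let n ≥ 2, and suppose there exist h₁, h₂, …, hₙ, h ∈ H with h₁h₂⋯hₙ = h (i.e. H ∩ Hⁿ ≠ ∅). Then H ∩ H² ≠ ∅, and hence H is a group (a maximal subgroup of S). -/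
open scoped Pointwise

theorem insert_mul_right_eq_iff {S : Type*} [Semigroup S] (x y : S) :
    insert x {z : S | ∃ s : S, z = x * s} = insert y {z : S | ∃ s : S, z = y * s} ↔
      (∃ p : WithOne S, (y : WithOne S) = x * p) ∧ ∃ q : WithOne S, (x : WithOne S) = y * q := by
  have mem (a b : S) : b ∈ insert a {z : S | ∃ s : S, z = a * s} ↔
      ∃ p : WithOne S, (b : WithOne S) = a * p := by
    simp only [Set.mem_insert_iff, Set.mem_ofPred_eq]
    rw [WithOne.exists]
    simp only [mul_one, ← WithOne.coe_mul, WithOne.coe_inj]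
  constructor
  · intro h
    exact ⟨(mem x y).1 (h ▸ Set.mem_insert y _), (mem y x).1 (h ▸ Set.mem_insert x _)⟩
  · rintro ⟨⟨p, hp⟩, q, hq⟩
    ext z
    rw [mem, mem]
    constructor
    · rintro ⟨r, hr⟩
      exact ⟨q * r, by rw [hr, hq, mul_assoc]⟩
    · rintro ⟨r, hr⟩
      exact ⟨p * r, by rw [hr, hp, mul_assoc]⟩

theorem insert_mul_left_eq_iff {S : Type*} [Semigroup S] (x y : S) :
    insert x {z : S | ∃ s : S, z = s * x} = insert y {z : S | ∃ s : S, z = s * y} ↔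
      (∃ p : WithOne S, (y : WithOne S) = p * x) ∧ ∃ q : WithOne S, (x : WithOne S) = q * y := by
  have mem (a b : S) : b ∈ insert a {z : S | ∃ s : S, z = s * a} ↔
      ∃ p : WithOne S, (b : WithOne S) = p * a := by
    simp only [Set.mem_insert_iff, Set.mem_ofPred_eq]
    rw [WithOne.exists]
    simp only [one_mul, ← WithOne.coe_mul, WithOne.coe_inj]
  constructor
  · intro h
    exact ⟨(mem x y).1 (h ▸ Set.mem_insert y _), (mem y x).1 (h ▸ Set.mem_insert x _)⟩
  · rintro ⟨⟨p, hp⟩, q, hq⟩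
    ext z
    rw [mem, mem]
    constructor
    · rintro ⟨r, hr⟩
      exact ⟨r * q, by rw [hr, hq, mul_assoc]⟩
    · rintro ⟨r, hr⟩
      exact ⟨r * p, by rw [hr, hp, mul_assoc]⟩

theorem greenH_iff {S : Type*} [Semigroup S] (x y : S) :
    GreenH x y ↔
      ((∃ p : WithOne S, (y : WithOne S) = x * p) ∧ ∃ q : WithOne S, (x : WithOne S) = y * q) ∧
      ((∃ p : WithOne S, (y : WithOne S) = p * x) ∧ ∃ q : WithOne S, (x : WithOne S) = q * y) :=
  and_congr (insert_mul_right_eq_iff x y) (insert_mul_left_eq_iff x y)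

theorem SetNPow.exists_eq_head_mul {S : Type*} [Semigroup S] (A : Set S) (k : ℕ) :
    ∀ y ∈ SetNPow A (k + 2), ∃ a ∈ A, ∃ b ∈ A, ∃ w : WithOne S, (y : WithOne S) = a * b * w := by
  induction k with
  | zero =>
    rintro _ ⟨a, ha, b, hb, rfl⟩
    exact ⟨a, ha, b, hb, 1, by simp⟩
  | succ k ih =>
    rintro _ ⟨p, hp, c, -, rfl⟩
    obtain ⟨a, ha, b, hb, w, hw⟩ := ih p hp
    exact ⟨a, ha, b, hb, w * c, by simp only [WithOne.coe_mul, hw, mul_assoc]⟩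

theorem SetNPow.exists_eq_mul_last {S : Type*} [Semigroup S] (A : Set S) (k : ℕ) :
    ∀ y ∈ SetNPow A (k + 2), ∃ a ∈ A, ∃ b ∈ A, ∃ w : WithOne S, (y : WithOne S) = w * a * b := by
  rintro _ ⟨p, hp, b, hb, rfl⟩
  cases k with
  | zero => exact ⟨p, hp, b, hb, 1, by simp⟩
  | succ k =>
    obtain ⟨q, -, a, ha, rfl⟩ := hp
    exact ⟨a, ha, b, hb, q, by simp⟩

theorem hclass_group_of_npow_meet (S : Type*) [Semigroup S] (x : S) (n : ℕ) (hn : 2 ≤ n)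
    (hne : (HClass x ∩ SetNPow (HClass x) n).Nonempty) :
    (HClass x ∩ SetNPow (HClass x) 2).Nonempty := by
  obtain ⟨k, rfl⟩ := Nat.exists_eq_add_of_le' hn
  obtain ⟨h, hh, hpow⟩ := hne
  obtain ⟨a, ha, b, hb, w, hw⟩ := SetNPow.exists_eq_head_mul _ k h hpow
  obtain ⟨c, hc, d, hd, v, hv⟩ := SetNPow.exists_eq_mul_last _ k h hpow
  obtain ⟨⟨-, q, hxq⟩, -, r, hxr⟩ := (greenH_iff x h).1 hh
  obtain ⟨⟨⟨a', ha'⟩, -⟩, -, t, hxt⟩ := (greenH_iff x a).1 ha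
  obtain ⟨⟨⟨b', hb'⟩, -⟩, -⟩ := (greenH_iff x b).1 hb
  obtain ⟨-, ⟨c', hc'⟩, -⟩ := (greenH_iff x c).1 hc
  obtain ⟨⟨-, u, hxu⟩, ⟨d', hd'⟩, -⟩ := (greenH_iff x d).1 hd
  have right_mul : (x : WithOne S) = x * x * (b' * w * q * a') := by
    calc (x : WithOne S) = t * a := hxt
      _ = t * (h * q * a') := by rw [← hxq, ← ha']
      _ = t * a * b * w * q * a' := by rw [hw]; simp only [mul_assoc]
      _ = x * x * (b' * w * q * a') := by rw [← hxt, hb']; simp only [mul_assoc]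
  have left_mul : (x : WithOne S) = d' * r * v * c' * (x * x) := by
    calc (x : WithOne S) = d * u := hxu
      _ = d' * (r * h) * u := by rw [← hxr, ← hd']
      _ = d' * r * v * c * (d * u) := by rw [hv]; simp only [mul_assoc]
      _ = d' * r * v * c' * (x * x) := by rw [← hxu, hc']; simp only [mul_assoc]
  rw [← WithOne.coe_mul] at right_mul left_mul
  exact ⟨x * x, (greenH_iff x (x * x)).2 ⟨⟨⟨x, WithOne.coe_mul x x⟩, _, right_mul⟩,
    ⟨x, WithOne.coe_mul x x⟩, _, left_mul⟩, Set.mul_mem_mul ⟨rfl, rfl⟩ ⟨rfl, rfl⟩⟩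
end

section
/- Every H-class of a completely separable semigroup is finite. -/
open scoped Pointwise

theorem GreenH.symm {S : Type*} [Semigroup S] {x y : S} (h : GreenH x y) : GreenH y x :=
  ⟨h.1.symm, h.2.symm⟩

theorem GreenH.trans {S : Type*} [Semigroup S] {x y z : S} (hxy : GreenH x y)
    (hyz : GreenH y z) : GreenH x z :=
  ⟨hxy.1.trans hyz.1, hxy.2.trans hyz.2⟩

theorem GreenH.eq_or_exists_eq_mul_right {S : Type*} [Semigroup S] {x y : S}
    (h : GreenH x y) : x = y ∨ ∃ s, x = y * s :=
  h.1.subset (Set.mem_insert x _)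

theorem GreenH.eq_or_exists_eq_mul_left {S : Type*} [Semigroup S] {x y : S}
    (h : GreenH x y) : x = y ∨ ∃ s, x = s * y :=
  h.2.subset (Set.mem_insert x _)

/-- A homomorphism separating `x` from its complement is injective on the H-class of `x`. -/
theorem injOn_hClass_of_separates {S U : Type*} [Semigroup S] [Semigroup U] (f : S →ₙ* U)
    {x : S} (hf : ∀ t, f t = f x → t = x) : Set.InjOn f (HClass x) := by
  intro y hy z hz hyz
  have hxy : GreenH x y := hy
  have hzy : GreenH z y := (show GreenH x z from hz).symm.trans hxy
  rcases hxy.eq_or_exists_eq_mul_right with rfl | ⟨s, hs⟩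
  · exact (hf z hyz.symm).symm
  have hzs : z * s = x := hf _ (by rw [map_mul, ← hyz, ← map_mul, ← hs])
  rcases hxy.symm.eq_or_exists_eq_mul_right with rfl | ⟨u, hu⟩
  · exact (hf z hyz.symm).symm
  rcases hzy.eq_or_exists_eq_mul_left with rfl | ⟨w, hw⟩
  · rfl
  calc y = z * s * u := by rw [hzs, ← hu]
    _ = w * (y * s * u) := by rw [hw]; simp only [mul_assoc]
    _ = z := by rw [← hs, ← hu, ← hw]

theorem completely_separable_hclass_finite (S : Type*) [Semigroup S]
    (hS : IsCompletelySeparable S) (x : S) :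
    (HClass x).Finite := by
  obtain ⟨U, _, _, f, hf⟩ := hS x
  exact Set.Finite.of_injOn (Set.mapsTo_univ f _)
    (injOn_hClass_of_separates f fun t ht => by_contra fun hne => hf ⟨t, hne, ht⟩)
    Set.finite_univ
end

section
/- Let S be a weakly subsemigroup separable semigroup and let H be an H-class of S. If there exists an element h ∈ H such that ah = ha for all a ∈ Stab(H), then the Schützenberger group Γ(H), viewed as a semigroup, is weakly subsemigroup separable. -/
open scoped Pointwise

section Auxiliary

variable {S : Type*} [Semigroup S]

theorem WithOne.exists_coe_eq_coe_mul (a : S) (u : WithOne S) :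
    ∃ s : S, (s : WithOne S) = (a : WithOne S) * u := by
  rcases eq_or_ne u 1 with rfl | hu
  · exact ⟨a, by simp⟩
  · obtain ⟨b, rfl⟩ := WithOne.ne_one_iff_exists.1 hu
    exact ⟨a * b, by simp⟩

theorem mem_insert_right_multiples_iff (a z : S) :
    z ∈ insert a {z : S | ∃ s : S, z = a * s} ↔
      ∃ u : WithOne S, (z : WithOne S) = (a : WithOne S) * u := by
  constructor
  · rintro (rfl | ⟨s, rfl⟩)
    · exact ⟨1, by simp⟩
    · exact ⟨(s : WithOne S), by simp⟩
  · rintro ⟨u, hu⟩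
    rcases eq_or_ne u 1 with rfl | hu1
    · exact Or.inl (by simpa using hu)
    · obtain ⟨b, rfl⟩ := WithOne.ne_one_iff_exists.1 hu1
      exact Or.inr ⟨b, by exact_mod_cast hu⟩

theorem mem_insert_left_multiples_iff (a z : S) :
    z ∈ insert a {z : S | ∃ s : S, z = s * a} ↔
      ∃ u : WithOne S, (z : WithOne S) = u * (a : WithOne S) := by
  constructor
  · rintro (rfl | ⟨s, rfl⟩)
    · exact ⟨1, by simp⟩
    · exact ⟨(s : WithOne S), by simp⟩
  · rintro ⟨u, hu⟩
    rcases eq_or_ne u 1 with rfl | hu1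
    · exact Or.inl (by simpa using hu)
    · obtain ⟨b, rfl⟩ := WithOne.ne_one_iff_exists.1 hu1
      exact Or.inr ⟨b, by exact_mod_cast hu⟩

theorem exists_left_multiplier_of_mem_hClass {x z w : S} (hz : z ∈ HClass x)
    (hw : w ∈ HClass x) : ∃ u : WithOne S, (w : WithOne S) = u * (z : WithOne S) := by
  rw [← mem_insert_left_multiples_iff, ← hz.2, hw.2]
  exact Set.mem_insert _ _

theorem mem_hClass_of_multipliers {x z w : S} (hz : z ∈ HClass x) (p q r s : WithOne S)
    (hp : (w : WithOne S) = z * p) (hq : (z : WithOne S) = w * q)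
    (hr : (w : WithOne S) = r * z) (hs : (z : WithOne S) = s * w) : w ∈ HClass x := by
  refine ⟨hz.1.trans ?_, hz.2.trans ?_⟩
  · ext t
    rw [mem_insert_right_multiples_iff, mem_insert_right_multiples_iff]
    constructor
    · rintro ⟨u, hu⟩
      exact ⟨q * u, by rw [hu, hq, mul_assoc]⟩
    · rintro ⟨u, hu⟩
      exact ⟨p * u, by rw [hu, hp, mul_assoc]⟩
  · ext t
    rw [mem_insert_left_multiples_iff, mem_insert_left_multiples_iff]
    constructor
    · rintro ⟨u, hu⟩
      exact ⟨u * s, by rw [hu, hs, mul_assoc]⟩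
    · rintro ⟨u, hu⟩
      exact ⟨u * r, by rw [hu, hr, mul_assoc]⟩

/-- An `H`-class containing an element `h = h * h * v` with `v` commuting with `h` contains an
idempotent. -/
theorem exists_idempotent_mem_hClass {x h : S} (hh : h ∈ HClass x) (v : WithOne S)
    (hv : Commute v (h : WithOne S)) (hhv : (h : WithOne S) = h * h * v) :
    ∃ e ∈ HClass x, e * e = e := by
  obtain ⟨e, he⟩ := WithOne.exists_coe_eq_coe_mul h v
  have he' : (e : WithOne S) = v * h := he.trans hv.eq.symm
  have h_right : (h : WithOne S) = h * e := by rw [he, ← mul_assoc, ← hhv]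
  have h_left : (h : WithOne S) = e * h := by
    rw [he, mul_assoc, hv.eq, ← mul_assoc, ← hhv]
  refine ⟨e, mem_hClass_of_multipliers hh v h v h he ?_ he' ?_, ?_⟩
  · exact h_left
  · exact h_right
  · apply WithOne.coe_injective
    rw [WithOne.coe_mul]
    nth_rw 1 [he']
    rw [mul_assoc, ← h_right, he']

theorem SchStab.exists_mul_eq {H : Set S} {a : WithOne S} (ha : a ∈ SchStab H) {z : S}
    (hz : z ∈ H) : ∃ w ∈ H, (w : WithOne S) = z * a := by
  have hmem : (z : WithOne S) * a ∈ (fun x : S => (x : WithOne S)) '' H := by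
    have ha' : (fun h => h * a) '' ((fun x : S => (x : WithOne S)) '' H)
      = (fun x : S => (x : WithOne S)) '' H := ha
    rw [← ha']
    exact ⟨_, ⟨z, hz, rfl⟩, rfl⟩
  obtain ⟨w, hw, hwz⟩ := hmem
  exact ⟨w, hw, hwz⟩

variable {x : S} {Γ : Type*} [Group Γ] {φ : SchStab (HClass x) →* Γ}

theorem IsSchutzenbergerGroup.map_eq_map_iff (hφ : IsSchutzenbergerGroup (HClass x) Γ φ)
    {z : S} (hz : z ∈ HClass x) (a b : SchStab (HClass x)) :
    φ a = φ b ↔ (z : WithOne S) * (a : WithOne S) = z * (b : WithOne S) := by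
  refine ⟨fun h => (hφ.2 a b).1 h z hz, fun h => (hφ.2 a b).2 fun w hw => ?_⟩
  obtain ⟨u, hu⟩ := exists_left_multiplier_of_mem_hClass hz hw
  rw [hu, mul_assoc, h, mul_assoc]

/-- Weak subsemigroup separability passes to the Schützenberger group of an `H`-class with an
idempotent, that class being a subgroup isomorphic to the Schützenberger group. -/
theorem IsSchutzenbergerGroup.isWeaklySubsemigroupSeparable_of_idempotent
    (hφ : IsSchutzenbergerGroup (HClass x) Γ φ) (hS : IsWeaklySubsemigroupSeparable S)
    {e : S} (he : e ∈ HClass x) (hee : e * e = e) : IsWeaklySubsemigroupSeparable Γ := by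
  classical
  choose lift hlift using hφ.1
  choose act hact hact_eq using fun γ : Γ => SchStab.exists_mul_eq (lift γ).2 he
  have hact_mul_e : ∀ γ, act γ * e = act γ := fun γ => by
    obtain ⟨u, hu⟩ := exists_left_multiplier_of_mem_hClass he (hact γ)
    apply WithOne.coe_injective
    rw [WithOne.coe_mul, hu, mul_assoc, ← WithOne.coe_mul, hee]
  let ψ : Γ →ₙ* S :=
    { toFun := act
      map_mul' := fun γ δ => by
        apply WithOne.coe_injective
        have key := (hφ.map_eq_map_iff he (lift (γ * δ)) (lift γ * lift δ)).1
          (by rw [map_mul, hlift, hlift, hlift])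
        rw [hact_eq, key, WithOne.coe_mul, hact_eq δ, ← mul_assoc, ← WithOne.coe_mul,
          hact_mul_e, hact_eq γ, mul_assoc, Submonoid.coe_mul] }
  have hinj : Function.Injective ψ := fun γ δ h => by
    have h' : act γ = act δ := h
    rw [← hlift γ, ← hlift δ, hφ.map_eq_map_iff he, ← hact_eq, ← hact_eq, h']
  rintro T ⟨Y, rfl⟩ g hg
  obtain ⟨U, _, _, f, hf⟩ := hS ((Subsemigroup.closure (Y : Set Γ)).map ψ)
    ⟨Y.image ψ, by rw [MulHom.map_mclosure, Finset.coe_image]⟩ (ψ g) (by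
      rintro ⟨t, ht, htg⟩
      exact hg (hinj htg ▸ ht))
  refine ⟨U, inferInstance, inferInstance, f.comp ψ, ?_⟩
  rintro ⟨t, ht, htg⟩
  exact hf ⟨ψ t, ⟨t, ht, rfl⟩, htg⟩

/-- A finite image of `S` yields a finite image of the Schützenberger group, through its action
on the image of the `H`-class. -/
theorem IsSchutzenbergerGroup.exists_finite_image (hφ : IsSchutzenbergerGroup (HClass x) Γ φ)
    {U : Type} [Semigroup U] [Finite U] (f : S →ₙ* U) :
    ∃ (V : Type) (_ : Semigroup V) (_ : Finite V) (ρ : Γ →ₙ* V),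
      ∀ (a b : SchStab (HClass x)), ρ (φ a) = ρ (φ b) → ∀ z ∈ HClass x, ∀ c d : S,
        (c : WithOne S) = z * a → (d : WithOne S) = z * b → f c = f d := by
  choose lift hlift using hφ.1
  let F : WithOne S →* WithOne U := WithOne.mapMulHom f
  have hF : ∀ s : S, F s = (f s : WithOne U) := fun s => WithOne.mapMulHom_coe f s
  let V : Set (WithOne U) := F '' ((fun s : S => (s : WithOne S)) '' HClass x)
  have : Finite (WithOne U) := inferInstanceAs (Finite (Option U))
  have hV : ∀ γ, ∀ v ∈ V, v * F (lift γ) ∈ V := by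
    rintro γ _ ⟨_, ⟨z, hz, rfl⟩, rfl⟩
    obtain ⟨w, hw, hwz⟩ := SchStab.exists_mul_eq (lift γ).2 hz
    exact ⟨_, ⟨w, hw, rfl⟩, by simp only [hwz, map_mul]⟩
  have hrep : ∀ (a : SchStab (HClass x)) (z : S), z ∈ HClass x →
      F z * F (lift (φ a)) = F (z * a) := fun a z hz => by
    rw [← map_mul, (hφ.map_eq_map_iff hz (lift (φ a)) a).1 (hlift _)]
  have : Finite (Function.End V) := inferInstanceAs (Finite (V → V))
  let act : Γ → Function.End V := fun γ v => ⟨v.1 * F (lift γ), hV γ v.1 v.2⟩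
  let ρ : Γ →ₙ* (Function.End V)ᵐᵒᵖ :=
    { toFun := fun γ => MulOpposite.op (act γ)
      map_mul' := fun γ δ => by
        rw [← MulOpposite.op_mul]
        congr 1
        funext v
        obtain ⟨_, _, ⟨z, hz, rfl⟩, rfl⟩ := v
        apply Subtype.ext
        change F z * F (lift (γ * δ)) = F z * F (lift γ) * F (lift δ)
        have key := hrep (lift γ * lift δ) z hz
        rw [map_mul, hlift, hlift] at key
        rw [key, Submonoid.coe_mul, map_mul, map_mul, mul_assoc] }
  have : Finite (Function.End V)ᵐᵒᵖ := Finite.of_injective _ MulOpposite.unop_injective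
  refine ⟨(Function.End V)ᵐᵒᵖ, inferInstance, this, ρ, fun a b hab z hz c d hc hd => ?_⟩
  have hact : act (φ a) = act (φ b) := MulOpposite.op_injective hab
  have hval : F z * F (lift (φ a)) = F z * F (lift (φ b)) :=
    congrArg Subtype.val (congrFun hact ⟨F z, _, ⟨z, hz, rfl⟩, rfl⟩)
  rw [hrep a z hz, hrep b z hz, ← hc, ← hd, hF, hF] at hval
  exact WithOne.coe_injective hval

/-- In an `H`-class without idempotents, an element `h` commuting with the stabiliser satisfies
no relation `h * a = h ^ k * b` over the stabiliser with `k ≠ 1`. -/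
theorem IsSchutzenbergerGroup.eq_one_of_mul_eq_pow_mul
    (hφ : IsSchutzenbergerGroup (HClass x) Γ φ) {h : S} (hh : h ∈ HClass x)
    (hcomm : ∀ a ∈ SchStab (HClass x), a * (h : WithOne S) = (h : WithOne S) * a)
    (hne : ¬ ∃ e ∈ HClass x, e * e = e) {k : ℕ} (a b : SchStab (HClass x))
    (hab : (h : WithOne S) * a = (h : WithOne S) ^ k * b) : k = 1 := by
  have hinv : ∀ a : SchStab (HClass x), ∃ a' : SchStab (HClass x),
      (h : WithOne S) * a * a' = h := fun a => by
    obtain ⟨a', ha'⟩ := hφ.1 (φ a)⁻¹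
    refine ⟨a', ?_⟩
    have key := (hφ.map_eq_map_iff hh (a * a') 1).1 (by rw [map_mul, ha', map_one,
      mul_inv_cancel])
    rwa [Submonoid.coe_mul, Submonoid.coe_one, mul_one, ← mul_assoc] at key
  obtain ⟨a', ha'⟩ := hinv a
  have hk : (h : WithOne S) = (h : WithOne S) ^ k * (b * a' : SchStab (HClass x)) := by
    rw [Submonoid.coe_mul, ← mul_assoc, ← hab, ha']
  by_contra hk1
  apply hne
  obtain rfl | ⟨n, rfl⟩ : k = 0 ∨ ∃ n, k = n + 2 := by
    rcases k with _ | _ | n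
    · exact Or.inl rfl
    · exact absurd rfl hk1
    · exact Or.inr ⟨n, rfl⟩
  · rw [pow_zero, one_mul] at hk
    obtain ⟨c, hc⟩ := hinv (b * a')
    refine exists_idempotent_mem_hClass hh c (hcomm c c.2) ?_
    rw [← hk] at hc
    exact hc.symm
  · refine exists_idempotent_mem_hClass hh
      ((h : WithOne S) ^ n * (b * a' : SchStab (HClass x))) ?_ ?_
    · exact ((Commute.refl _).pow_left n).mul_left (hcomm _ (b * a').2)
    · conv_lhs => rw [hk]
      rw [add_comm n 2, pow_add, pow_two, mul_assoc]

/-- In an `H`-class without idempotents, an element `h` commuting with the stabiliser allows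
the orbit of `h` under a finitely generated subsemigroup of the Schützenberger group to be placed
in a finitely generated subsemigroup of `S`, without capturing further points of the orbit. -/
theorem IsSchutzenbergerGroup.exists_fg_subsemigroup
    (hφ : IsSchutzenbergerGroup (HClass x) Γ φ) {h : S} (hh : h ∈ HClass x)
    (hcomm : ∀ a ∈ SchStab (HClass x), a * (h : WithOne S) = (h : WithOne S) * a)
    (hne : ¬ ∃ e ∈ HClass x, e * e = e) (Y : Finset Γ) :
    ∃ Z : Finset S, ∀ (a : SchStab (HClass x)) (s : S), (s : WithOne S) = h * a →
      (s ∈ Subsemigroup.closure (Z : Set S) ↔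
        φ a ∈ Subsemigroup.closure (Y : Set Γ)) := by
  classical
  choose lift hlift using hφ.1
  have hfin : {s : S | ∃ y ∈ Y, (s : WithOne S) = lift y ∨
      (s : WithOne S) = h * lift y}.Finite := by
    refine Set.Finite.of_finite_image (f := fun s : S => (s : WithOne S))
      (((Y.image fun y => (lift y : WithOne S)) ∪
        (Y.image fun y => (h : WithOne S) * lift y)).finite_toSet.subset ?_)
      (WithOne.coe_injective.injOn)
    rintro _ ⟨s, ⟨y, hy, hs | hs⟩, rfl⟩
    · exact Finset.mem_union_left _ (Finset.mem_image.2 ⟨y, hy, hs.symm⟩)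
    · exact Finset.mem_union_right _ (Finset.mem_image.2 ⟨y, hy, hs.symm⟩)
  have hupper : ∀ s ∈ Subsemigroup.closure (hfin.toFinset : Set S),
      ∃ (k : ℕ) (b : SchStab (HClass x)), φ b ∈ Subsemigroup.closure (Y : Set Γ) ∧
        (s : WithOne S) = (h : WithOne S) ^ k * b := by
    intro s hs
    induction hs using Subsemigroup.closure_induction with
    | mem s hs =>
      obtain ⟨y, hy, hs | hs⟩ := hfin.mem_toFinset.1 hs
      · exact ⟨0, lift y, by rw [hlift]; exact Subsemigroup.subset_closure hy, by simpa using hs⟩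
      · exact ⟨1, lift y, by rw [hlift]; exact Subsemigroup.subset_closure hy, by simpa using hs⟩
    | mul s t _ _ ihs iht =>
      obtain ⟨k, b, hb, hs⟩ := ihs
      obtain ⟨l, c, hc, ht⟩ := iht
      refine ⟨k + l, b * c, by rw [map_mul]; exact mul_mem hb hc, ?_⟩
      have hbl : Commute (b : WithOne S) ((h : WithOne S) ^ l) :=
        Commute.pow_right (hcomm b b.2) l
      rw [WithOne.coe_mul, hs, ht, Submonoid.coe_mul, pow_add, mul_assoc,
        ← mul_assoc (b : WithOne S), hbl.eq, mul_assoc, mul_assoc]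
  have hlower : ∀ γ ∈ Subsemigroup.closure (Y : Set Γ), ∃ b : SchStab (HClass x), φ b = γ ∧
      ((b : WithOne S) = 1 ∨
        ∃ t ∈ Subsemigroup.closure (hfin.toFinset : Set S), (t : WithOne S) = b) ∧
      ∃ t ∈ Subsemigroup.closure (hfin.toFinset : Set S), (t : WithOne S) = h * b := by
    intro γ hγ
    induction hγ using Subsemigroup.closure_induction with
    | mem y hy =>
      refine ⟨lift y, hlift y, ?_, ?_⟩
      · rcases eq_or_ne (lift y : WithOne S) 1 with h1 | h1
        · exact Or.inl h1
        · obtain ⟨t, ht⟩ := WithOne.ne_one_iff_exists.1 h1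
          exact Or.inr ⟨t, Subsemigroup.subset_closure
            (hfin.mem_toFinset.2 ⟨y, hy, Or.inl ht⟩), ht⟩
      · obtain ⟨t, ht⟩ := WithOne.exists_coe_eq_coe_mul h (lift y : WithOne S)
        exact ⟨t, Subsemigroup.subset_closure
          (hfin.mem_toFinset.2 ⟨y, hy, Or.inr ht⟩), ht⟩
    | mul γ δ _ _ ihγ ihδ =>
      obtain ⟨b, rfl, hb, p, hp, hpb⟩ := ihγ
      obtain ⟨c, rfl, hc, q, hq, hqc⟩ := ihδ
      refine ⟨b * c, map_mul φ b c, ?_, ?_⟩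
      · rcases hb with hb | ⟨s, hs, hsb⟩
        · simpa [hb] using hc
        · rcases hc with hc | ⟨t, ht, htc⟩
          · exact Or.inr ⟨s, hs, by simp [hc, hsb]⟩
          · exact Or.inr ⟨s * t, mul_mem hs ht, by simp [hsb, htc]⟩
      · rcases hc with hc | ⟨t, ht, htc⟩
        · exact ⟨p, hp, by simp [hc, hpb]⟩
        · exact ⟨p * t, mul_mem hp ht, by simp [hpb, htc, mul_assoc]⟩
  refine ⟨hfin.toFinset, fun a s hs => ⟨fun hmem => ?_, fun hmem => ?_⟩⟩
  · obtain ⟨k, b, hb, hsb⟩ := hupper s hmem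
    obtain rfl := hφ.eq_one_of_mul_eq_pow_mul hh hcomm hne a b (hs ▸ hsb)
    rw [pow_one, hs] at hsb
    rwa [(hφ.map_eq_map_iff hh a b).2 hsb]
  · obtain ⟨b, hba, -, t, ht, htb⟩ := hlower _ hmem
    have hts : t = s := WithOne.coe_injective
      (by rw [htb, hs, (hφ.map_eq_map_iff hh b a).1 hba])
    exact hts ▸ ht

end Auxiliary

theorem schutzenberger_weakly_separable_of_central (S : Type*) [Semigroup S]
    (hS : IsWeaklySubsemigroupSeparable S) (x : S) (h : S) (hh : h ∈ HClass x)
    (hcomm : ∀ a ∈ SchStab (HClass x), a * (h : WithOne S) = (h : WithOne S) * a)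
    (Γ : Type*) [Group Γ] (φ : SchStab (HClass x) →* Γ)
    (hφ : IsSchutzenbergerGroup (HClass x) Γ φ) :
    IsWeaklySubsemigroupSeparable Γ := by
  by_cases hne : ∃ e ∈ HClass x, e * e = e
  · obtain ⟨e, he, hee⟩ := hne
    exact hφ.isWeaklySubsemigroupSeparable_of_idempotent hS he hee
  rintro T ⟨Y, rfl⟩ g hg
  obtain ⟨Z, hZ⟩ := hφ.exists_fg_subsemigroup hh hcomm hne Y
  obtain ⟨a, rfl⟩ := hφ.1 g
  obtain ⟨s, hs⟩ := WithOne.exists_coe_eq_coe_mul h (a : WithOne S)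
  obtain ⟨U, _, _, f, hf⟩ := hS _ ⟨Z, rfl⟩ s (fun hmem => hg ((hZ a s hs).1 hmem))
  obtain ⟨V, hV, hfin, ρ, hρ⟩ := hφ.exists_finite_image f
  refine ⟨V, hV, hfin, ρ, ?_⟩
  rintro ⟨t, ht, hta⟩
  obtain ⟨b, rfl⟩ := hφ.1 t
  obtain ⟨r, hr⟩ := WithOne.exists_coe_eq_coe_mul h (b : WithOne S)
  exact hf ⟨r, (hZ b r hr).2 ht, hρ b a hta h hh r s hr hs⟩
end

section
/- Let S be a semigroup and let H be an H-class of S. If S is weakly subsemigroup separable, then the Schützenberger group Γ(H) satisfies the separability property with respect to the collection of all finitely generated abelian subgroups: for every finitely generated abelian subgroup G of Γ(H) and every b ∈ Γ(H) \ G, there exist a finite group K and a homomorphism θ : Γ(H) → K such that θ(b) ∉ θ(G). -/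
open scoped Pointwise

/-- A monoid in which every element outside a finitely generated submonoid can be separated
from it in a finite monoid image. -/
def IsWeaklySubmonoidSeparable (M : Type*) [Monoid M] : Prop :=
  ∀ Y : Set M, Y.Finite → ∀ s : M, s ∉ Submonoid.closure Y →
    ∃ (U : Type) (_ : Monoid U) (_ : Finite U) (f : M →* U),
      ∀ v ∈ Submonoid.closure Y, f v ≠ f s

theorem IsWeaklySubsemigroupSeparable.withOne {S : Type*} [Semigroup S]
    (hS : IsWeaklySubsemigroupSeparable S) : IsWeaklySubmonoidSeparable (WithOne S) := by
  classical
  intro Y hY s hs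
  have hcoe : Function.Injective ((↑) : S → WithOne S) := WithOne.coe_injective
  set Z : Set S := ((↑) : S → WithOne S) ⁻¹' Y
  have hZf : Z.Finite := hY.preimage hcoe.injOn
  have hZY : ∀ z ∈ Subsemigroup.closure Z, (z : WithOne S) ∈ Submonoid.closure Y := by
    intro z hz
    induction hz using Subsemigroup.closure_induction with
    | mem z hz => exact Submonoid.subset_closure hz
    | mul a b _ _ ha hb => simpa using mul_mem ha hb
  have hYZ : ∀ v ∈ Submonoid.closure Y,
      v = 1 ∨ ∃ z ∈ Subsemigroup.closure Z, v = (z : WithOne S) := by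
    intro v hv
    induction hv using Submonoid.closure_induction with
    | mem v hv =>
      by_cases h1 : v = 1
      · exact Or.inl h1
      · obtain ⟨z, rfl⟩ := WithOne.ne_one_iff_exists.1 h1
        exact Or.inr ⟨z, Subsemigroup.subset_closure hv, rfl⟩
    | one => exact Or.inl rfl
    | mul a b _ _ ha hb =>
      rcases ha with rfl | ⟨z, hz, rfl⟩
      · simpa using hb
      · rcases hb with rfl | ⟨w, hw, rfl⟩
        · exact Or.inr ⟨z, hz, by simp⟩
        · exact Or.inr ⟨z * w, mul_mem hz hw, by simp⟩
  obtain ⟨s, rfl⟩ := WithOne.ne_one_iff_exists.1 fun h : s = 1 => hs (h ▸ one_mem _)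
  obtain ⟨U, hU, hfin, f, hf⟩ := hS (Subsemigroup.closure Z)
    ⟨hZf.toFinset, by simp⟩ s (fun h => hs (hZY s h))
  refine ⟨WithOne U, inferInstance, inferInstanceAs (Finite (Option U)),
    WithOne.mapMulHom f, ?_⟩
  intro v hv
  rcases hYZ v hv with rfl | ⟨z, hz, rfl⟩
  · simp
  · intro h
    simp only [WithOne.mapMulHom_coe, WithOne.coe_inj] at h
    exact hf ⟨z, hz, h⟩

/-- `φ : St →* Γ` realises the Schützenberger group of the H-class of `x` in a monoid. -/
structure IsSchutzenbergerMap {M Γ : Type*} [Monoid M] [Group Γ] (x : M) (St : Submonoid M)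
    (φ : St →* Γ) : Prop where
  mem_iff : ∀ s, s ∈ St ↔ (∃ b, x * s * b = x) ∧ (∃ c, x * s = c * x) ∧ ∃ d, x = d * (x * s)
  surjective : Function.Surjective φ
  eq_iff : ∀ s t : St, φ s = φ t ↔ x * (s : M) = x * t

theorem exists_eq_pow_of_eq_mul_mul_self {U : Type*} [Monoid U] [Finite U] {h d : U}
    (hd : h = d * h * h) : ∃ n : ℕ, h = h ^ (n + 2) := by
  have key : ∀ n : ℕ, h = d ^ n * h ^ (n + 1) := by
    intro n
    induction n with
    | zero => simp
    | succ n ih =>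
      calc h = d ^ n * h ^ (n + 1) := ih
        _ = d ^ n * (h * h ^ n) := by rw [pow_succ' h n]
        _ = d ^ n * (d * h * h * h ^ n) := by rw [← hd]
        _ = d ^ (n + 1) * h ^ (n + 1 + 1) := by
          simp only [pow_succ d, pow_succ' h, mul_assoc]
  obtain ⟨i, j, hij, he⟩ := Finite.exists_ne_map_eq_of_infinite (fun n : ℕ => h ^ n)
  wlog hlt : i < j generalizing i j
  · exact this j i hij.symm he.symm (by omega)
  obtain ⟨k, rfl⟩ : ∃ k, j = i + k + 1 := ⟨j - i - 1, by omega⟩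
  refine ⟨k, ?_⟩
  calc h = d ^ i * h ^ (i + 1) := key i
    _ = d ^ i * (h ^ i * h) := by rw [pow_succ]
    _ = d ^ i * (h ^ (i + k + 1) * h) := by rw [he]
    _ = d ^ i * h ^ (i + 1) * h ^ (k + 1) := by
      rw [mul_assoc, ← pow_succ, ← pow_add]; congr 2; omega
    _ = h ^ (k + 2) := by rw [← key i, ← pow_succ']

theorem exists_eq_pow_of_eq_mul_mul {U : Type*} [Monoid U] [Finite U] {h u w : U}
    (hu : h = u * h * w) : ∃ n : ℕ, h = u ^ (n + 1) * h := by
  have key : ∀ n : ℕ, h = u ^ n * h * w ^ n := by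
    intro n
    induction n with
    | zero => simp
    | succ n ih =>
      calc h = u ^ n * h * w ^ n := ih
        _ = u ^ n * (u * h * w) * w ^ n := by rw [← hu]
        _ = u ^ (n + 1) * h * w ^ (n + 1) := by
          simp only [pow_succ u, pow_succ' w, mul_assoc]
  obtain ⟨i, j, hij, he⟩ := Finite.exists_ne_map_eq_of_infinite (fun n : ℕ => u ^ n)
  wlog hlt : i < j generalizing i j
  · exact this j i hij.symm he.symm (by omega)
  obtain ⟨k, rfl⟩ : ∃ k, j = (k + 1) + i := ⟨j - i - 1, by omega⟩
  refine ⟨k, ?_⟩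
  calc h = u ^ i * h * w ^ i := key i
    _ = u ^ (k + 1 + i) * h * w ^ i := by rw [he]
    _ = u ^ (k + 1) * (u ^ i * h * w ^ i) := by simp only [pow_add, mul_assoc]
    _ = u ^ (k + 1) * h := by rw [← key i]

/-- An element that is not a group element cannot lie `J`-below a product `x * t * x` with
`x * t` lying `L`-below `x`. -/
theorem IsWeaklySubmonoidSeparable.ne_mul_of_forall_pow_ne {M : Type*} [Monoid M]
    (hM : IsWeaklySubmonoidSeparable M) {x : M} (hx : ∀ n : ℕ, x ≠ x ^ (n + 2))
    {α t β v : M} (hv : x * t = v * x) : x ≠ α * x * t * x * β := by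
  intro h
  have hmem : x ∉ Submonoid.closure ({x ^ 2, x ^ 3} : Set M) := by
    intro hmem
    have : ∀ y ∈ Submonoid.closure ({x ^ 2, x ^ 3} : Set M), y = 1 ∨ ∃ n : ℕ, y = x ^ (n + 2) := by
      intro y hy
      induction hy using Submonoid.closure_induction with
      | mem y hy =>
        rcases hy with rfl | rfl
        · exact Or.inr ⟨0, rfl⟩
        · exact Or.inr ⟨1, rfl⟩
      | one => exact Or.inl rfl
      | mul a b _ _ ha hb =>
        rcases ha with rfl | ⟨m, rfl⟩
        · simpa using hb
        · rcases hb with rfl | ⟨n, rfl⟩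
          · exact Or.inr ⟨m, by simp⟩
          · exact Or.inr ⟨m + n + 2, by rw [← pow_add]; congr 1; omega⟩
    rcases this x hmem with h1 | ⟨n, hn⟩
    · exact hx 0 (by simp [h1])
    · exact hx n hn
  have hpow : ∀ n : ℕ, x ^ (n + 2) ∈ Submonoid.closure ({x ^ 2, x ^ 3} : Set M) := by
    intro n
    induction n using Nat.twoStepInduction with
    | zero => exact Submonoid.subset_closure (by simp)
    | one => exact Submonoid.subset_closure (by simp)
    | more n ih _ =>
      have : x ^ (n + 2 + 2) = x ^ (n + 2) * x ^ 2 := pow_add _ _ _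
      rw [this]
      exact mul_mem ih (Submonoid.subset_closure (by simp))
  obtain ⟨U, _, _, f, hf⟩ := hM _ (by simp) x hmem
  have h1 : f x = f (α * x * t) * f x * f β := by
    rw [← map_mul, ← map_mul, ← h]
  obtain ⟨n, hn⟩ := exists_eq_pow_of_eq_mul_mul h1
  have h2 : f x = f ((α * x * t) ^ n * (α * v)) * f x * f x := by
    rw [← map_mul, ← map_mul]
    have : (α * x * t) ^ n * (α * v) * x * x = (α * x * t) ^ (n + 1) * x := by
      rw [pow_succ, mul_assoc α x t, hv]; simp only [mul_assoc]
    rw [this, map_mul, map_pow]; exact hn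
  obtain ⟨m, hm⟩ := exists_eq_pow_of_eq_mul_mul_self h2
  exact hf _ (hpow m) (by rw [map_pow]; exact hm.symm)

theorem exists_finite_sets_addHeight {M : Type*} [AddCommGroup M] [Module.Finite ℤ M]
    (Y : Set M) :
    ∃ (F₁ F₂ : Set M) (ψ : M →+ ℤ), F₁.Finite ∧ F₂.Finite ∧ F₁ ⊆ Y ∧ (∀ y ∈ Y, ψ y = 0) ∧
      (∀ c ∈ F₂, ψ c = 1) ∧ ∀ N : ℕ, 0 < N → ∀ g : M, ∃ k : ℕ, 0 < k ∧
        k • g ∈ AddSubgroup.closure ((fun y => N • y) '' F₁ ∪ F₂) := by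
  classical
  obtain ⟨F, hFY, hF⟩ := (Submodule.fg_span_iff_fg_span_finset_subset (R := ℤ) Y).1
    (IsNoetherian.noetherian _)
  set Q := M ⧸ Submodule.span ℤ Y
  set R := Q ⧸ Submodule.torsion ℤ Q
  let π : M →ₗ[ℤ] R := (Submodule.mkQ _).comp (Submodule.mkQ _)
  have hπ : Function.Surjective π :=
    (Submodule.mkQ_surjective _).comp (Submodule.mkQ_surjective _)
  let B := Module.Free.chooseBasis ℤ R
  choose c hc using fun i => hπ (B i)
  let τ : R →ₗ[ℤ] ℤ := B.constr ℤ (fun _ => (1 : ℤ))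
  refine ⟨F, Set.range c, (τ.comp π).toAddMonoidHom, F.finite_toSet, Set.finite_range c, hFY,
    ?_, ?_, ?_⟩
  · intro y hy
    have : (Submodule.span ℤ Y).mkQ y = 0 := by
      simpa using Submodule.subset_span hy
    simp [π, this]
  · rintro _ ⟨i, rfl⟩
    simp [hc, τ]
  · intro N hN g
    set L := AddSubgroup.closure ((fun y => N • y) '' (F : Set M) ∪ Set.range c)
    set r := ∑ i, B.repr (π g) i • c i with hr
    have hcL : ∀ i, c i ∈ L := fun i => AddSubgroup.subset_closure (Or.inr ⟨i, rfl⟩)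
    have hrL : r ∈ L := sum_mem fun i _ => zsmul_mem (hcL i) _
    have hgr : π (g - r) = 0 := by
      rw [map_sub, hr, map_sum]
      simp only [map_smul, hc]
      rw [B.sum_repr, sub_self]
    have htor : (Submodule.span ℤ Y).mkQ (g - r) ∈ Submodule.torsion ℤ Q :=
      (Submodule.Quotient.mk_eq_zero _).1 hgr
    obtain ⟨⟨a, ha⟩, hak⟩ := (Submodule.mem_torsion_iff _).1 htor
    have ha0 : a ≠ 0 := nonZeroDivisors.ne_zero ha
    have hmem : a • (g - r) ∈ Submodule.span ℤ (F : Set M) := by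
      rw [← hF, ← Submodule.Quotient.mk_eq_zero]
      simpa using hak
    have hspan : ∀ y ∈ Submodule.span ℤ (F : Set M), N • y ∈ L := by
      intro y hy
      induction hy using Submodule.span_induction with
      | mem y hy => exact AddSubgroup.subset_closure (Or.inl ⟨y, hy, rfl⟩)
      | zero => simp
      | add a b _ _ ha hb => rw [smul_add]; exact add_mem ha hb
      | smul a y _ hy => rw [smul_comm]; exact zsmul_mem hy a
    have h1 : (N * a.natAbs : ℕ) • (g - r) ∈ L := by
      have h2 := hspan _ hmem
      rw [mul_smul]
      rcases Int.natAbs_eq a with h | h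
      · rw [h, natCast_zsmul] at h2; exact h2
      · rw [h, neg_smul, natCast_zsmul, smul_neg] at h2; exact neg_mem_iff.1 h2
    refine ⟨N * a.natAbs, Nat.mul_pos hN (Int.natAbs_pos.2 ha0), ?_⟩
    rw [smul_sub] at h1
    simpa using add_mem h1 (nsmul_mem hrL (N * a.natAbs))

theorem exists_finite_sets_height {G : Type*} [CommGroup G] [Group.FG G] (Y : Set G) :
    ∃ (F₁ F₂ : Set G) (ψ : G → ℤ), F₁.Finite ∧ F₂.Finite ∧ F₁ ⊆ Y ∧
      (∀ a b, ψ (a * b) = ψ a + ψ b) ∧ (∀ y ∈ Y, ψ y = 0) ∧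
      (∀ c ∈ F₂, ψ c = 1) ∧ ∀ N : ℕ, 0 < N →
        Finite (G ⧸ Subgroup.closure ((fun y => y ^ N) '' F₁ ∪ F₂)) := by
  obtain ⟨F₁, F₂, ψ, h1, h2, h3, h4, h5, h6⟩ :=
    exists_finite_sets_addHeight (M := Additive G) Y
  refine ⟨F₁, F₂, fun g => ψ (Additive.ofMul g), h1, h2, h3, fun a b => ?_, h4, h5, ?_⟩
  · simp
  · intro N hN
    apply CommGroup.finite_of_fg_isMulTorsion
    intro q
    obtain ⟨g, rfl⟩ := QuotientGroup.mk_surjective q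
    obtain ⟨k, hk, hkg⟩ := h6 N hN (Additive.ofMul g)
    refine isOfFinOrder_iff_pow_eq_one.2 ⟨k, hk, ?_⟩
    rw [← QuotientGroup.mk_pow, QuotientGroup.eq_one_iff]
    have key : ∀ z ∈ AddSubgroup.closure ((fun y : Additive G => N • y) '' F₁ ∪ F₂),
        z.toMul ∈ Subgroup.closure ((fun y : G => y ^ N) '' F₁ ∪ F₂) := by
      intro z hz
      induction hz using AddSubgroup.closure_induction with
      | mem z hz => exact Subgroup.subset_closure hz
      | zero => exact one_mem _
      | add a b _ _ ha hb => exact mul_mem ha hb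
      | neg a _ ha => exact inv_mem ha
    exact key _ hkg

theorem exists_finite_quotient_of_cosets {Γ : Type*} [Group Γ] (G : Subgroup Γ)
    (L : Subgroup G) [Finite (G ⧸ L)] (b : Γ)
    (h : ∀ g : G, ∃ (K : Type) (_ : Group K) (_ : Finite K) (θ : Γ →* K),
      ∀ l ∈ L, θ ((g : Γ)⁻¹ * b) ≠ θ l) :
    ∃ (K : Type) (_ : Group K) (_ : Finite K) (θ : Γ →* K), θ b ∉ θ '' (G : Set Γ) := by
  choose K hK hfin θ hθ using h
  obtain ⟨n, ⟨e⟩⟩ := Finite.exists_equiv_fin (G ⧸ L)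
  let r : Fin n → G := fun i => (e.symm i).out
  refine ⟨∀ i, K (r i), inferInstance, inferInstance, MonoidHom.pi fun i => θ (r i), ?_⟩
  rintro ⟨g, hg, hgb⟩
  set i := e (QuotientGroup.mk (⟨g, hg⟩ : G)) with hi
  have hri : (QuotientGroup.mk (r i) : G ⧸ L) = QuotientGroup.mk (⟨g, hg⟩ : G) := by
    simp [r, hi]
  have hl := QuotientGroup.eq.1 hri
  refine hθ (r i) _ hl ?_
  have := congrFun hgb i
  have : θ (r i) g = θ (r i) b := this
  simp [this]

theorem IsSchutzenbergerMap.exists_finite_quotient {M Γ : Type*} [Monoid M] [Group Γ] {x : M}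
    {St : Submonoid M} {φ : St →* Γ} (hφ : IsSchutzenbergerMap x St φ)
    {U : Type} [Monoid U] [Finite U] (f : M →* U) (P : Set Γ) (y : Γ)
    (hsep : ∀ s t : St, φ s = y → φ t ∈ Submonoid.closure P → f (x * s) ≠ f (x * t)) :
    ∃ (K : Type) (_ : Group K) (_ : Finite K) (θ : Γ →* K),
      ∀ l ∈ Subgroup.closure P, θ y ≠ θ l := by
  choose lam hlam using hφ.surjective
  let W := {u : U // ∃ s : St, u = f (x * s)}
  have hcong : ∀ (s t t' : St), φ t = φ t' → f (x * s) * f t = f (x * s) * f t' := by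
    intro s t t' h
    have : x * ((s * t : St) : M) = x * ((s * t' : St) : M) := by
      rw [← hφ.eq_iff, map_mul, map_mul, h]
    simp only [Submonoid.coe_mul, ← mul_assoc] at this
    rw [← map_mul, ← map_mul, this]
  let act : Γ →* (Function.End W)ᵐᵒᵖ :=
    { toFun := fun γ => MulOpposite.op fun w => ⟨w.1 * f (lam γ), by
        obtain ⟨_, s, rfl⟩ := w
        exact ⟨s * lam γ, by simp [mul_assoc]⟩⟩
      map_one' := by
        apply MulOpposite.unop_injective
        funext w
        obtain ⟨_, s, rfl⟩ := w
        apply Subtype.ext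
        change f (x * s) * f (lam 1) = f (x * s)
        rw [hcong s (lam 1) 1 (by rw [hlam, map_one])]
        simp
      map_mul' := by
        intro γ δ
        apply MulOpposite.unop_injective
        funext w
        obtain ⟨_, s, rfl⟩ := w
        apply Subtype.ext
        change f (x * s) * f (lam (γ * δ)) = f (x * s) * f (lam γ) * f (lam δ)
        rw [hcong s (lam (γ * δ)) (lam γ * lam δ) (by rw [hlam, map_mul, hlam, hlam])]
        simp [mul_assoc] }
  have : Finite (Function.End W) := inferInstanceAs (Finite (W → W))
  have : Finite (Function.End W)ᵐᵒᵖ := Finite.of_equiv _ MulOpposite.opEquiv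
  refine ⟨_, inferInstance, inferInstance, act.toHomUnits, ?_⟩
  intro l hl he
  have hfin : ∀ l ∈ Subgroup.closure P,
      ∃ p ∈ Submonoid.closure P, act.toHomUnits l = act.toHomUnits p := by
    intro l hl
    have h1 : act.toHomUnits l ∈ (Subgroup.closure P).map act.toHomUnits :=
      ⟨l, hl, rfl⟩
    rw [MonoidHom.map_closure, ← Subgroup.mem_toSubmonoid,
      Subgroup.closure_toSubmonoid_of_finite, ← MonoidHom.map_mclosure] at h1
    obtain ⟨p, hp, hpe⟩ := h1
    exact ⟨p, hp, hpe.symm⟩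
  obtain ⟨p, hp, hpe⟩ := hfin l hl
  have h2 : act y = act p := congrArg Units.val (he.trans hpe)
  have h3 := congrFun (MulOpposite.op_injective h2) ⟨f (x * (1 : St)), 1, rfl⟩
  have h4 : f (x * (1 : St)) * f (lam y) = f (x * (1 : St)) * f (lam p) :=
    congrArg Subtype.val h3
  refine hsep (lam y) (lam p) (hlam y) (by rwa [hlam]) ?_
  simpa using h4

namespace IsSchutzenbergerMap

variable {M Γ : Type*} [Monoid M] [Group Γ] {x : M} {St : Submonoid M} {φ : St →* Γ}

theorem exists_inv (hφ : IsSchutzenbergerMap x St φ) (s : St) :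
    ∃ s' : St, φ s' = (φ s)⁻¹ ∧ x * s * s' = x := by
  obtain ⟨s', hs'⟩ := hφ.surjective (φ s)⁻¹
  refine ⟨s', hs', ?_⟩
  have : x * ((s * s' : St) : M) = x * (1 : St) := by
    rw [← hφ.eq_iff, map_mul, hs', map_one, mul_inv_cancel]
  simpa [mul_assoc] using this

theorem exists_mul_eq (hφ : IsSchutzenbergerMap x St φ) (s : St) : ∃ v, x * s = v * x :=
  ((hφ.mem_iff s).1 s.2).2.1

theorem exists_finite_quotient_of_eq_pow (hφ : IsSchutzenbergerMap x St φ)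
    (hM : IsWeaklySubmonoidSeparable M) {n : ℕ} (hx : x = x ^ (n + 2)) (G : Subgroup Γ)
    (hfg : G.FG) (b : Γ) (hb : b ∉ G) :
    ∃ (K : Type) (_ : Group K) (_ : Finite K) (θ : Γ →* K), θ b ∉ θ '' (G : Set Γ) := by
  classical
  set e := x ^ (n + 1) with he
  have hxe : x * e = x := by rw [he, ← pow_succ', ← hx]
  have hex : ∀ s : M, e * s = x ^ n * (x * s) := fun s => by rw [he, pow_succ, mul_assoc]
  have hese : ∀ s : St, e * s * e = e * s := by
    intro s
    obtain ⟨v, hv⟩ := hφ.exists_mul_eq s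
    rw [hex, mul_assoc, hv, mul_assoc v, hxe]
  have heq : ∀ s t : St, φ s = φ t ↔ e * (s : M) = e * t := by
    intro s t
    rw [hφ.eq_iff]
    constructor
    · intro h; rw [hex, hex, h]
    · intro h; rw [← hxe, mul_assoc, h, ← mul_assoc]
  choose lam hlam using hφ.surjective
  obtain ⟨F, rfl⟩ := hfg
  set Y : Set M := insert e ((fun g => e * (lam g : M)) '' (F : Set Γ))
  have hV : ∀ v ∈ Submonoid.closure Y,
      v = 1 ∨ ∃ s : St, v = e * s ∧ φ s ∈ Subgroup.closure (F : Set Γ) := by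
    intro v hv
    induction hv using Submonoid.closure_induction with
    | mem v hv =>
      rcases hv with rfl | ⟨g, hg, rfl⟩
      · exact Or.inr ⟨1, by simp, by simp⟩
      · exact Or.inr ⟨lam g, rfl, by rw [hlam]; exact Subgroup.subset_closure hg⟩
    | one => exact Or.inl rfl
    | mul u v _ _ hu hv =>
      rcases hu with rfl | ⟨s, rfl, hs⟩
      · simpa using hv
      · rcases hv with rfl | ⟨t, rfl, ht⟩
        · exact Or.inr ⟨s, by simp, hs⟩
        · refine Or.inr ⟨s * t, ?_, by rw [map_mul]; exact mul_mem hs ht⟩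
          rw [← mul_assoc, hese, Submonoid.coe_mul, mul_assoc]
  have hbV : e * (lam b : M) ∉ Submonoid.closure Y := by
    intro h
    apply hb
    rcases hV _ h with h1 | ⟨s, hs, hsG⟩
    · have h2 : e = e * lam b := by
        rw [← hese (lam b), h1, one_mul]
      have h3 : φ 1 = φ (lam b) := (heq _ _).2 (by simpa using h2)
      rw [hlam, map_one] at h3
      rw [← h3]; exact one_mem _
    · rw [← hlam b, (heq _ _).2 hs]; exact hsG
  have hmem : ∀ l ∈ Submonoid.closure (F : Set Γ), ∀ t : St, φ t = l →
      e * (t : M) ∈ Submonoid.closure Y := by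
    intro l hl
    induction hl using Submonoid.closure_induction with
    | mem l hl =>
      intro t ht
      rw [(heq t (lam l)).1 (by rw [ht, hlam])]
      exact Submonoid.subset_closure (Or.inr ⟨l, hl, rfl⟩)
    | one =>
      intro t ht
      rw [(heq t 1).1 (by rw [ht, map_one])]
      exact Submonoid.subset_closure (Or.inl (by simp))
    | mul u v _ _ hu hv =>
      intro t ht
      rw [(heq t (lam u * lam v)).1 (by rw [ht, map_mul, hlam, hlam]), Submonoid.coe_mul,
        ← mul_assoc, ← hese (lam u), mul_assoc]
      exact mul_mem (hu _ (hlam u)) (hv _ (hlam v))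
  obtain ⟨U, _, _, f, hf⟩ := hM Y ((F.finite_toSet.image _).insert e) _ hbV
  obtain ⟨K, i₁, i₂, θ, hθ⟩ := hφ.exists_finite_quotient f (F : Set Γ) b (by
    intro s t hs ht h
    apply hf _ (hmem _ ht t rfl)
    rw [← (heq s (lam b)).1 (by rw [hs, hlam]), hex, hex, map_mul, map_mul _ _ (x * (s : M)), h])
  exact ⟨K, i₁, i₂, θ, fun ⟨g, hg, h⟩ => hθ g hg h.symm⟩

theorem exists_finite_quotient_ne_one (hφ : IsSchutzenbergerMap x St φ)
    (hM : IsWeaklySubmonoidSeparable M) (hx : ∀ n : ℕ, x ≠ x ^ (n + 2)) (z : Γ) (hz : z ≠ 1) :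
    ∃ (K : Type) (_ : Group K) (_ : Finite K) (θ : Γ →* K), θ z ≠ 1 := by
  obtain ⟨s, rfl⟩ := hφ.surjective z
  have hs : x * (s : M) ∉ Submonoid.closure {x} := by
    intro h
    obtain ⟨n, hn⟩ := Submonoid.mem_closure_singleton.1 h
    obtain ⟨s', -, hs'⟩ := hφ.exists_inv s
    match n, hn with
    | 0, hn =>
      exact hM.ne_mul_of_forall_pow_ne hx (α := 1) (t := 1) (β := s) (v := 1) (by simp)
        (by simp [mul_assoc, ← hn])
    | 1, hn =>
      apply hz
      rw [← map_one φ, hφ.eq_iff]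
      simpa using hn.symm
    | n + 2, hn =>
      refine hM.ne_mul_of_forall_pow_ne hx (α := x ^ n) (t := 1) (β := s') (v := 1) (by simp) ?_
      rw [mul_one, ← pow_succ, ← pow_succ, hn, hs']
  obtain ⟨U, _, _, f, hf⟩ := hM {x} (Set.finite_singleton x) _ hs
  obtain ⟨K, i₁, i₂, θ, hθ⟩ := hφ.exists_finite_quotient f ∅ (φ s) (by
    intro a t ha ht h
    rw [Submonoid.closure_empty, Submonoid.mem_bot] at ht
    apply hf x (Submonoid.subset_closure rfl)
    rw [← (hφ.eq_iff _ _).1 ha, h, (hφ.eq_iff t 1).1 (by rw [ht, map_one])]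
    simp)
  exact ⟨K, i₁, i₂, θ, by simpa using hθ 1 (one_mem _)⟩

theorem mem_closure_insert_cases (Z : Set St) {v : M}
    (hv : v ∈ Submonoid.closure (insert x ((↑) '' Z : Set M))) :
    (∃ t ∈ Submonoid.closure Z, v = t) ∨
      (∃ t₀ ∈ Submonoid.closure Z, ∃ t₁ : St, t₁ ∈ Submonoid.closure Z ∧ v = t₀ * x * t₁) ∨
      ∃ (α β : M) (t : St), v = α * x * t * x * β := by
  induction hv using Submonoid.closure_induction_left with
  | one => exact Or.inl ⟨1, one_mem _, by simp⟩
  | mul_left g hg y _ ih =>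
    rcases hg with rfl | ⟨z, hz, rfl⟩
    · rcases ih with ⟨t, ht, rfl⟩ | ⟨t₀, -, t₁, -, rfl⟩ | ⟨α, β, t, rfl⟩
      · exact Or.inr (Or.inl ⟨1, one_mem _, t, ht, by simp⟩)
      · exact Or.inr (Or.inr ⟨1, t₁, t₀, by simp [mul_assoc]⟩)
      · exact Or.inr (Or.inr ⟨g * α, β, t, by simp [mul_assoc]⟩)
    · rcases ih with ⟨t, ht, rfl⟩ | ⟨t₀, h₀, t₁, h₁, rfl⟩ | ⟨α, β, t, rfl⟩
      · exact Or.inl ⟨z * t, mul_mem (Submonoid.subset_closure hz) ht, by simp⟩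
      · exact Or.inr (Or.inl ⟨z * t₀, mul_mem (Submonoid.subset_closure hz) h₀, t₁, h₁,
          by simp [mul_assoc]⟩)
      · exact Or.inr (Or.inr ⟨z * α, β, t, by simp [mul_assoc]⟩)

theorem exists_finite_quotient_of_pow_mem (hφ : IsSchutzenbergerMap x St φ)
    (hM : IsWeaklySubmonoidSeparable M) (hx : ∀ n : ℕ, x ≠ x ^ (n + 2)) (G A D : Subgroup Γ)
    (hfg : G.FG) (hab : ∀ a ∈ G, ∀ b ∈ G, a * b = b * a) (hGA : G ≤ A) (hGD : G ≤ D) {N : ℕ}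
    (hN : 0 < N) (hAD : ∀ a ∈ A, a ^ N ∈ D) {b : Γ} (hbA : b ∈ A) (hbD : b ∉ D) :
    ∃ (K : Type) (_ : Group K) (_ : Finite K) (θ : Γ →* K), θ b ∉ θ '' (G : Set Γ) := by
  let _ : CommGroup G :=
    { (inferInstance : Group G) with
      mul_comm := fun a b => Subtype.ext (hab a a.2 b b.2) }
  have : Group.FG G := (Group.fg_iff_subgroup_fg G).2 hfg
  obtain ⟨F₁, F₂, ψ, hF₁, hF₂, hF₁Y, hψ, hψY, hψF₂, hfin⟩ := exists_finite_sets_height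
    {g : G | ∃ q s : St, φ q = g ∧ (q : M) * x = x * s ∧ φ s ∈ A}
  have hψ1 : ψ 1 = 0 := by simpa using hψ 1 1
  have hlift : ∀ g ∈ F₁, ∃ q s : St, φ q = g ∧ (q : M) * x = x * s ∧ φ s ∈ A :=
    fun g hg => hF₁Y hg
  choose! q s hq hqx hs using hlift
  choose lam hlam using hφ.surjective
  set Z : Set St := (fun g => q g ^ N) '' F₁ ∪ (fun g : G => lam g) '' F₂
  have hZf : Z.Finite := (hF₁.image _).union (hF₂.image _)
  have hqpow : ∀ g ∈ F₁, ∀ k : ℕ, ((q g ^ k : St) : M) * x = x * ((s g ^ k : St) : M) := by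
    intro g hg k
    induction k with
    | zero => simp
    | succ k ih =>
      rw [pow_succ, pow_succ', Submonoid.coe_mul, Submonoid.coe_mul, mul_assoc, hqx g hg,
        ← mul_assoc, ih, mul_assoc]
      simp only [← Submonoid.coe_mul, ← pow_succ, ← pow_succ']
  have hT : ∀ w ∈ Submonoid.closure Z, ∃ g : G, φ w = g ∧ 0 ≤ ψ g ∧
      (ψ g = 0 → ∃ r : St, (w : M) * x = x * r ∧ φ r ∈ D) := by
    intro w hw
    induction hw using Submonoid.closure_induction with
    | mem w hw =>
      rcases hw with ⟨g, hg, rfl⟩ | ⟨g, hg, rfl⟩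
      · have h0 : ∀ k : ℕ, ψ (g ^ k) = 0 := by
          intro k
          induction k with
          | zero => simpa using hψ1
          | succ k ih => rw [pow_succ, hψ, ih, hψY g ⟨q g, s g, hq g hg, hqx g hg, hs g hg⟩, add_zero]
        refine ⟨g ^ N, by rw [map_pow, hq g hg]; rfl, (h0 N).ge, fun _ => ⟨s g ^ N, hqpow g hg N, ?_⟩⟩
        rw [map_pow]
        exact hAD _ (hs g hg)
      · refine ⟨g, hlam g, by rw [hψF₂ g hg]; exact zero_le_one, fun h => ?_⟩
        rw [hψF₂ g hg] at h
        exact absurd h one_ne_zero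
    | one => exact ⟨1, by simp, hψ1.ge, fun _ => ⟨1, by simp, by simp⟩⟩
    | mul u v _ _ hu hv =>
      obtain ⟨g, hg, hg0, hgr⟩ := hu
      obtain ⟨h, hh, hh0, hhr⟩ := hv
      refine ⟨g * h, by rw [map_mul, hg, hh]; rfl, by rw [hψ]; exact add_nonneg hg0 hh0, ?_⟩
      intro h0
      rw [hψ] at h0
      obtain ⟨r, hr, hrD⟩ := hgr (by omega)
      obtain ⟨r', hr', hrD'⟩ := hhr (by omega)
      refine ⟨r * r', ?_, by rw [map_mul]; exact mul_mem hrD hrD'⟩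
      rw [Submonoid.coe_mul, Submonoid.coe_mul, mul_assoc, hr', ← mul_assoc, hr, mul_assoc]
  have := hfin N hN
  refine exists_finite_quotient_of_cosets G (Subgroup.closure ((fun y => y ^ N) '' F₁ ∪ F₂)) b ?_
  intro g
  set y := (g : Γ)⁻¹ * b with hy
  have hyA : y ∈ A := mul_mem (inv_mem (hGA g.2)) hbA
  have hyD : y ∉ D := fun h => hbD (by simpa [hy] using mul_mem (hGD g.2) h)
  have hyV : x * (lam y : M) ∉ Submonoid.closure (insert x ((↑) '' Z : Set M)) := by
    intro h
    obtain ⟨y', -, hy'⟩ := hφ.exists_inv (lam y)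
    rcases mem_closure_insert_cases Z h with ⟨t, ht, h⟩ | ⟨t₀, h₀, t₁, h₁, h⟩ | ⟨α, β, t, h⟩
    · obtain ⟨t', -, ht'⟩ := hφ.exists_inv t
      refine hM.ne_mul_of_forall_pow_ne hx (α := 1) (t := 1) (β := lam y * t') (v := 1)
        (by simp) ?_
      rw [← h] at ht'
      simpa [mul_assoc] using ht'.symm
    · obtain ⟨t', htφ, ht'⟩ := hφ.exists_inv t₁
      obtain ⟨g₀, hg₀, -, hr⟩ := hT t₀ h₀
      obtain ⟨g₁, hg₁, -⟩ := hT t₁ h₁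
      have h2 : (t₀ : M) * x = x * ((lam y * t' : St) : M) := by
        rw [Submonoid.coe_mul, ← mul_assoc, h, mul_assoc, mul_assoc, ← mul_assoc x, ht']
      have hA : φ (lam y * t') ∈ A := by
        rw [map_mul, hlam, htφ, hg₁]
        exact mul_mem hyA (inv_mem (hGA g₁.2))
      obtain ⟨r, hr, hrD⟩ := hr (hψY g₀ ⟨t₀, lam y * t', hg₀, h2, hA⟩)
      rw [(hφ.eq_iff r (lam y * t')).2 (hr.symm.trans h2), map_mul, hlam, htφ, hg₁] at hrD
      exact hyD (by simpa using mul_mem hrD (hGD g₁.2))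
    · obtain ⟨v, hv⟩ := hφ.exists_mul_eq t
      refine hM.ne_mul_of_forall_pow_ne hx (α := α) (t := t) (β := β * y') (v := v) hv ?_
      rw [← mul_assoc, ← h, hy']
  obtain ⟨U, _, _, f, hf⟩ := hM _ ((hZf.image _).insert x) _ hyV
  have hTV : ∀ t ∈ Submonoid.closure Z,
      (t : M) ∈ Submonoid.closure (insert x ((↑) '' Z : Set M)) := by
    intro t ht
    have : (t : M) ∈ (Submonoid.closure Z).map St.subtype := ⟨t, ht, rfl⟩
    rw [MonoidHom.map_mclosure] at this
    exact Submonoid.closure_mono (Set.subset_insert _ _) this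
  obtain ⟨K, i₁, i₂, θ, hθ⟩ := hφ.exists_finite_quotient f (φ '' Z) y (by
    intro a t ha ht h
    rw [← MonoidHom.map_mclosure] at ht
    obtain ⟨t', ht', htt⟩ := ht
    refine hf (x * t') (mul_mem (Submonoid.subset_closure (Or.inl rfl)) (hTV t' ht')) ?_
    rw [(hφ.eq_iff _ _).1 htt, ← h, (hφ.eq_iff a (lam y)).1 (by rw [ha, hlam])])
  refine ⟨K, i₁, i₂, θ, fun l hl => hθ l ?_⟩
  have hle : Subgroup.closure ((fun y => y ^ N) '' F₁ ∪ F₂) ≤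
      (Subgroup.closure (φ '' Z)).comap G.subtype := by
    rw [Subgroup.closure_le]
    rintro _ (⟨c, hc, rfl⟩ | hc)
    · refine Subgroup.subset_closure ⟨q c ^ N, Or.inl ⟨c, hc, rfl⟩, ?_⟩
      rw [map_pow, hq c hc]; rfl
    · exact Subgroup.subset_closure ⟨lam _, Or.inr ⟨_, hc, rfl⟩, hlam _⟩
  exact hle hl

end IsSchutzenbergerMap

/-- The product `G⟨c⟩` of a subgroup and a cyclic subgroup commuting with it. -/
def Subgroup.mulZPowers {Γ : Type*} [Group Γ] (G : Subgroup Γ) (c : Γ)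
    (hc : ∀ g ∈ G, Commute g c) : Subgroup Γ where
  carrier := {y | ∃ g ∈ G, ∃ i : ℤ, y = g * c ^ i}
  one_mem' := ⟨1, one_mem _, 0, by simp⟩
  mul_mem' := by
    rintro _ _ ⟨g, hg, i, rfl⟩ ⟨h, hh, j, rfl⟩
    refine ⟨g * h, mul_mem hg hh, i + j, ?_⟩
    rw [zpow_add, mul_assoc, ← mul_assoc _ h, ← ((hc h hh).zpow_right i).eq]
    simp only [mul_assoc]
  inv_mem' := by
    rintro _ ⟨g, hg, i, rfl⟩
    refine ⟨g⁻¹, inv_mem hg, -i, ?_⟩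
    rw [mul_inv_rev, zpow_neg]
    exact (((hc _ (inv_mem hg)).zpow_right i).inv_right).eq.symm

theorem IsSchutzenbergerMap.exists_finite_quotient_of_abelian {M Γ : Type*} [Monoid M] [Group Γ]
    {x : M} {St : Submonoid M} {φ : St →* Γ} (hφ : IsSchutzenbergerMap x St φ)
    (hM : IsWeaklySubmonoidSeparable M) (G : Subgroup Γ) (hfg : G.FG)
    (hab : ∀ a ∈ G, ∀ b ∈ G, a * b = b * a) (b : Γ) (hb : b ∉ G) :
    ∃ (K : Type) (_ : Group K) (_ : Finite K) (θ : Γ →* K), θ b ∉ θ '' (G : Set Γ) := by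
  by_cases hx : ∃ n : ℕ, x = x ^ (n + 2)
  · obtain ⟨n, hx⟩ := hx
    exact hφ.exists_finite_quotient_of_eq_pow hM hx G hfg b hb
  push Not at hx
  by_cases hc : ∀ g ∈ G, Commute g b
  · obtain ⟨N, hN, hNb⟩ : ∃ N : ℕ, 0 < N ∧ ∀ i : ℤ, b ^ (1 + N * i) ∉ G := by
      by_cases hk : ∃ k : ℕ, 0 < k ∧ b ^ k ∈ G
      · obtain ⟨k, hk, hkG⟩ := hk
        refine ⟨k, hk, fun i h => hb ?_⟩
        rw [zpow_add, zpow_one, zpow_mul, zpow_natCast] at h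
        exact (mul_mem_cancel_right (zpow_mem hkG i)).1 h
      · push Not at hk
        refine ⟨2, two_pos, fun i h => ?_⟩
        refine hk (1 + (2 : ℕ) * i).natAbs (by omega) ?_
        rw [← zpow_natCast]
        rcases Int.natAbs_eq (1 + (2 : ℕ) * i) with h' | h'
        · rwa [← h']
        · rw [h', zpow_neg] at h
          exact inv_mem_iff.1 h
    have hcN : ∀ g ∈ G, Commute g (b ^ N) := fun g hg => (hc g hg).pow_right N
    refine hφ.exists_finite_quotient_of_pow_mem hM hx G (G.mulZPowers b hc)
      (G.mulZPowers (b ^ N) hcN) hfg hab (fun g hg => ⟨g, hg, 0, by simp⟩)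
      (fun g hg => ⟨g, hg, 0, by simp⟩) hN ?_ ⟨1, one_mem _, 1, by simp⟩ ?_
    · rintro _ ⟨g, hg, i, rfl⟩
      refine ⟨g ^ N, pow_mem hg N, i, ?_⟩
      rw [((hc g hg).zpow_right i).mul_pow, ← zpow_natCast b N, ← zpow_natCast (b ^ i) N,
        ← zpow_mul, ← zpow_mul, mul_comm i]
    · rintro ⟨g, hg, i, h⟩
      apply hNb (-i)
      have : g = b ^ (1 + (N : ℤ) * -i) := by
        rw [mul_neg, zpow_add, zpow_one, zpow_neg, zpow_mul, zpow_natCast]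
        exact eq_mul_inv_of_mul_eq h.symm
      rwa [← this]
  · push Not at hc
    obtain ⟨g, hg, hgb⟩ := hc
    obtain ⟨K, i₁, i₂, θ, hθ⟩ := hφ.exists_finite_quotient_ne_one hM hx (g * b * (b * g)⁻¹)
      (fun h => hgb (mul_inv_eq_one.1 h))
    refine ⟨K, i₁, i₂, θ, ?_⟩
    rintro ⟨a, ha, hab'⟩
    apply hθ
    rw [map_mul, map_mul, map_inv, map_mul, ← hab', ← map_mul, ← map_mul, hab g hg a ha,
      mul_inv_cancel]

theorem mem_image_coe_HClass {S : Type*} [Semigroup S] {x : S} {y : WithOne S} :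
    y ∈ (fun x : S => (x : WithOne S)) '' HClass x ↔
      (∃ a, y = x * a) ∧ (∃ b, (x : WithOne S) = y * b) ∧ (∃ c, y = c * x) ∧
        ∃ d, (x : WithOne S) = d * y := by
  have hR : ∀ u v : S, (∃ a : WithOne S, (v : WithOne S) = u * a) ↔ v = u ∨ ∃ s, v = u * s := by
    intro u v
    constructor
    · rintro ⟨a, ha⟩
      by_cases h : a = 1
      · subst h; left; simpa using ha
      · obtain ⟨s, rfl⟩ := WithOne.ne_one_iff_exists.1 h
        right; exact ⟨s, by exact_mod_cast ha⟩
    · rintro (rfl | ⟨s, rfl⟩)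
      · exact ⟨1, by simp⟩
      · exact ⟨s, by simp⟩
  have hL : ∀ u v : S, (∃ a : WithOne S, (v : WithOne S) = a * u) ↔ v = u ∨ ∃ s, v = s * u := by
    intro u v
    constructor
    · rintro ⟨a, ha⟩
      by_cases h : a = 1
      · subst h; left; simpa using ha
      · obtain ⟨s, rfl⟩ := WithOne.ne_one_iff_exists.1 h
        right; exact ⟨s, by exact_mod_cast ha⟩
    · rintro (rfl | ⟨s, rfl⟩)
      · exact ⟨1, by simp⟩
      · exact ⟨s, by simp⟩
  have hRs : ∀ u v : S,
      insert u {z : S | ∃ s : S, z = u * s} ⊆ insert v {z : S | ∃ s : S, z = v * s} ↔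
      (u = v ∨ ∃ s, u = v * s) := by
    intro u v
    constructor
    · intro h; exact h (Set.mem_insert _ _)
    · rintro (rfl | ⟨s, rfl⟩)
      · exact subset_rfl
      · rintro z (rfl | ⟨t, rfl⟩)
        · exact Or.inr ⟨s, rfl⟩
        · exact Or.inr ⟨s * t, mul_assoc _ _ _⟩
  have hLs : ∀ u v : S,
      insert u {z : S | ∃ s : S, z = s * u} ⊆ insert v {z : S | ∃ s : S, z = s * v} ↔
      (u = v ∨ ∃ s, u = s * v) := by
    intro u v
    constructor
    · intro h; exact h (Set.mem_insert _ _)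
    · rintro (rfl | ⟨s, rfl⟩)
      · exact subset_rfl
      · rintro z (rfl | ⟨t, rfl⟩)
        · exact Or.inr ⟨s, rfl⟩
        · exact Or.inr ⟨t * s, (mul_assoc _ _ _).symm⟩
  have key : ∀ y : S, y ∈ HClass x ↔ (∃ a, (y : WithOne S) = x * a) ∧
      (∃ b, (x : WithOne S) = y * b) ∧ (∃ c, (y : WithOne S) = c * x) ∧
        ∃ d, (x : WithOne S) = d * y := by
    intro y
    rw [hR, hR, hL, hL, ← hRs, ← hRs, ← hLs, ← hLs]
    change GreenH x y ↔ _
    rw [GreenH, Set.Subset.antisymm_iff, Set.Subset.antisymm_iff]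
    tauto
  constructor
  · rintro ⟨y, hy, rfl⟩
    exact (key y).1 hy
  · intro h
    have h1 : y ≠ 1 := by
      rintro rfl
      obtain ⟨⟨a, ha⟩, -⟩ := h
      by_cases h : a = 1
      · subst h; simp at ha
      · obtain ⟨s, rfl⟩ := WithOne.ne_one_iff_exists.1 h
        rw [← WithOne.coe_mul] at ha
        exact WithOne.one_ne_coe ha
    obtain ⟨y, rfl⟩ := WithOne.ne_one_iff_exists.1 h1
    exact ⟨y, (key y).2 h, rfl⟩

theorem mem_SchStab_HClass_iff {S : Type*} [Semigroup S] {x : S} {s : WithOne S} :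
    s ∈ SchStab (HClass x) ↔ (∃ b, (x : WithOne S) * s * b = x) ∧
      (∃ c, (x : WithOne S) * s = c * x) ∧ ∃ d, (x : WithOne S) = d * (x * s) := by
  change (fun h => h * s) '' ((fun x : S => (x : WithOne S)) '' HClass x)
      = (fun x : S => (x : WithOne S)) '' HClass x ↔ _
  set X := (x : WithOne S)
  have hX : X ∈ (fun x : S => (x : WithOne S)) '' HClass x :=
    mem_image_coe_HClass.2 ⟨⟨1, (mul_one _).symm⟩, ⟨1, (mul_one _).symm⟩,
      ⟨1, (one_mul _).symm⟩, ⟨1, (one_mul _).symm⟩⟩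
  constructor
  · intro h
    have : X * s ∈ (fun x : S => (x : WithOne S)) '' HClass x := h ▸ ⟨X, hX, rfl⟩
    obtain ⟨-, ⟨b, hb⟩, hc, hd⟩ := mem_image_coe_HClass.1 this
    exact ⟨⟨b, hb.symm⟩, hc, hd⟩
  · rintro ⟨⟨b, hb⟩, ⟨c, hc⟩, ⟨d, hd⟩⟩
    have hfix : ∀ u, u * X * s * b = u * X := fun u => by
      rw [mul_assoc u, mul_assoc u, hb]
    apply Set.Subset.antisymm
    · rintro _ ⟨y, hy, rfl⟩
      obtain ⟨⟨a₁, h₁⟩, ⟨a₂, h₂⟩, ⟨a₃, h₃⟩, ⟨a₄, h₄⟩⟩ := mem_image_coe_HClass.1 hy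
      refine mem_image_coe_HClass.2 ⟨⟨a₁ * s, ?_⟩, ⟨b * a₂, ?_⟩, ⟨a₃ * c, ?_⟩, ⟨d * a₄, ?_⟩⟩
      · change y * s = _
        rw [h₁, mul_assoc]
      · change X = y * s * (b * a₂)
        rw [← mul_assoc, h₃, hfix, ← h₃, ← h₂]
      · change y * s = a₃ * c * X
        rw [h₃, mul_assoc, hc, mul_assoc]
      · change X = d * a₄ * (y * s)
        rw [mul_assoc, ← mul_assoc a₄, ← h₄, ← hd]
    · intro y hy
      obtain ⟨⟨a₁, h₁⟩, ⟨a₂, h₂⟩, ⟨a₃, h₃⟩, ⟨a₄, h₄⟩⟩ := mem_image_coe_HClass.1 hy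
      have hy' : y = a₃ * d * (X * s) := by rw [mul_assoc, ← hd, h₃]
      have hyb : y * b = a₃ * d * X := by rw [hy', mul_assoc, hb]
      have hybs : y * b * s = y := by rw [hyb, hy', mul_assoc _ X]
      refine ⟨y * b, mem_image_coe_HClass.2
        ⟨⟨a₁ * b, ?_⟩, ⟨s * a₂, ?_⟩, ⟨a₃ * d, hyb⟩, ⟨c * a₄, ?_⟩⟩, hybs⟩
      · rw [h₁, mul_assoc]
      · change X = _
        rw [← mul_assoc, hybs, ← h₂]
      · change X = _
        rw [mul_assoc, ← mul_assoc a₄, ← h₄, ← mul_assoc, ← hc, hb]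

theorem IsSchutzenbergerGroup.isSchutzenbergerMap {S : Type*} [Semigroup S] {x : S} {Γ : Type*}
    [Group Γ] {φ : SchStab (HClass x) →* Γ} (hφ : IsSchutzenbergerGroup (HClass x) Γ φ) :
    IsSchutzenbergerMap (x : WithOne S) (SchStab (HClass x)) φ where
  mem_iff _ := mem_SchStab_HClass_iff
  surjective := hφ.1
  eq_iff s t := by
    rw [hφ.2]
    constructor
    · exact fun h => h x ⟨rfl, rfl⟩
    · intro h y hy
      obtain ⟨-, -, ⟨c, hc⟩, -⟩ := mem_image_coe_HClass.1
        (Set.mem_image_of_mem (fun x : S => (x : WithOne S)) hy)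
      change (y : WithOne S) = c * x at hc
      rw [hc, mul_assoc, h, mul_assoc]

theorem schutzenberger_fg_abelian_subgroup_separable (S : Type*) [Semigroup S]
    (hS : IsWeaklySubsemigroupSeparable S) (x : S)
    (Γ : Type*) [Group Γ] (φ : SchStab (HClass x) →* Γ)
    (hφ : IsSchutzenbergerGroup (HClass x) Γ φ)
    (G : Subgroup Γ) (hfg : G.FG) (hab : ∀ a ∈ G, ∀ b ∈ G, a * b = b * a)
    (b : Γ) (hb : b ∉ G) :
    ∃ (K : Type) (_ : Group K) (_ : Finite K) (θ : Γ →* K),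
      θ b ∉ θ '' (G : Set Γ) := by
  exact hφ.isSchutzenbergerMap.exists_finite_quotient_of_abelian hS.withOne G hfg hab b hb
end
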